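/- Let n ≥ 1, let F be a finite field of odd order q and characteristic p, and let π be a set of primes with 2 ∈ π, 3 ∈ π, and p ∉ π. If the symplectic group Sp_{2n}(F) possesses a π-Hall subgroup, then the symmetric group Sym_n possesses a π-Hall subgroup, SL_2(F) possesses a π-Hall subgroup, and every prime in π dividing |Sp_{2n}(F)| divides q² − 1. -/

import Mathlib

/-- `n` is a `π`-number: every prime dividing `n` lies in `π`. -/
def IsPiNumber (π : Set ℕ) (n : ℕ) : Prop :=
  ∀ p : ℕ, p.Prime → p ∣ n → p ∈ π

/-- `H` is a `π`-Hall subgroup of `G`: its order is a `π`-number and no prime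
in `π` divides its index. -/
def IsHallPi (π : Set ℕ) {G : Type*} [Group G] (H : Subgroup G) : Prop :=
  IsPiNumber π (Nat.card H) ∧ ∀ p ∈ π, p.Prime → ¬ p ∣ H.index

/-- The conjugate `g K g⁻¹` of a subgroup `K`. -/
def conjSub {G : Type*} [Group G] (g : G) (K : Subgroup G) : Subgroup G :=
  K.map (MulAut.conj g).toMonoidHom


section allhelpers
open Matrix


/-! ### Two by two matrices -/

section TwoByTwo
set_option linter.unusedSectionVars false
set_option linter.unusedVariables false
set_option linter.unusedSimpArgs false
variable {L : Type*} [Field L] [CharZero L]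

lemma m2_trace_zero_of_anticomm {I J : Matrix (Fin 2) (Fin 2) L} (hI : I * I = -1) (hJ : J * J = -1)
    (hIJ : J * I = -(I * J)) : I.trace = 0 := by
  have h1 : J * I * J = I := by
    rw [hIJ, neg_mul, mul_assoc, hJ]; simp
  have h2 : (J * I * J).trace = -I.trace := by
    rw [Matrix.trace_mul_comm, ← mul_assoc, hJ]; simp
  rw [h1] at h2
  linear_combination (1/2) * h2

lemma m2_det_one {κ : Matrix (Fin 2) (Fin 2) L} (h : κ * κ = -1) (ht : κ.trace = 0) :
    κ.det = 1 := by
  have h1 := congrFun (congrFun h 0) 0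
  simp only [Matrix.mul_apply, Fin.sum_univ_two, Matrix.neg_apply, Matrix.one_apply_eq] at h1
  rw [Matrix.trace_fin_two] at ht
  rw [Matrix.det_fin_two]
  linear_combination -h1 + κ 0 0 * ht

lemma m2_cramer {a b c a' b' c' u v w : L} (hd : -a * a - b * c = 1) (hd' : -a' * a' - b' * c' = 1)
    (he : 2 * a * a' + b * c' + b' * c = 0) (h1 : u * a + v * b + w * c = 0)
    (h2 : u * a' + v * b' + w * c' = 0)
    (h3 : u * (a * a' + b * c') + v * (a * b' - b * a') + w * (c * a' - a * c') = 0) :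
    u = 0 ∧ v = 0 ∧ w = 0 := by
  set k := a * a' + b * c' with hk
  set l := a * b' - b * a' with hl
  set m := c * a' - a * c' with hm
  have hD : k * (b * c' - c * b') + 2 * l * m = -2 := by
    rw [hk, hl, hm]
    linear_combination (a * a' + b * c') * he - 2 * (-a' * a' - b' * c') * hd - 2 * hd'
  refine ⟨?_, ?_, ?_⟩
  · linear_combination (-1/2) * (h1 * (b' * m - c' * l) - h2 * (b * m - c * l)
      + h3 * (b * c' - c * b')) + (1/2) * u * hD
  · linear_combination (-1/2) * (- h1 * (a' * m - c' * k) + h2 * (a * m - c * k)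
      - h3 * (a * c' - c * a')) + (1/2) * v * hD
  · linear_combination (-1/2) * (h1 * (a' * l - b' * k) - h2 * (a * l - b * k)
      + h3 * (a * b' - b * a')) + (1/2) * w * hD

lemma m2_scalar {I J : Matrix (Fin 2) (Fin 2) L} (hI : I * I = -1) (hJ : J * J = -1)
    (hIJ : J * I = -(I * J)) {Y : Matrix (Fin 2) (Fin 2) L}
    (h1 : (Y * I).trace = 0) (h2 : (Y * J).trace = 0) (h3 : (Y * (I * J)).trace = 0) :
    Y = (Y.trace / 2) • (1 : Matrix (Fin 2) (Fin 2) L) := by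
  have tI := m2_trace_zero_of_anticomm hI hJ hIJ
  have tJ := m2_trace_zero_of_anticomm hJ hI (by rw [hIJ, neg_neg])
  have dI := m2_det_one hI tI
  have dJ := m2_det_one hJ tJ
  have e := congrFun (congrFun hIJ 0) 0
  rw [Matrix.trace_fin_two] at tI tJ
  rw [Matrix.det_fin_two] at dI dJ
  simp only [Matrix.trace_fin_two, Matrix.mul_apply, Fin.sum_univ_two, Matrix.neg_apply] at *
  have eI : I 1 1 = -I 0 0 := by linear_combination tI
  have eJ : J 1 1 = -J 0 0 := by linear_combination tJ
  rw [eI] at dI h1 h3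
  rw [eJ] at dJ h2 h3
  obtain ⟨hu, hv, hw⟩ := m2_cramer (a := I 0 0) (b := I 0 1) (c := I 1 0) (a' := J 0 0)
    (b' := J 0 1) (c' := J 1 0) (u := Y 0 0 - Y 1 1) (v := Y 1 0) (w := Y 0 1)
    (by linear_combination dI) (by linear_combination dJ) (by linear_combination e)
    (by linear_combination h1) (by linear_combination h2) (by linear_combination h3 - Y 1 1 * e)
  ext x y
  fin_cases x <;> fin_cases y
  · simp; linear_combination (1/2) * hu
  · simpa using hw
  · simpa using hv
  · simp; linear_combination (-1/2) * hu

/-- For `I, J` as above, `I n I + J n J + K n K = n - 2 tr n`. -/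
lemma m2_sum {I J : Matrix (Fin 2) (Fin 2) L} (hI : I * I = -1) (hJ : J * J = -1)
    (hIJ : J * I = -(I * J)) (n : Matrix (Fin 2) (Fin 2) L) :
    I * n * I + J * n * J + (I * J) * n * (I * J) = n - (2 * n.trace) • 1 := by
  have tI := m2_trace_zero_of_anticomm hI hJ hIJ
  have tJ := m2_trace_zero_of_anticomm hJ hI (by rw [hIJ, neg_neg])
  have hK : (I * J) * (I * J) = -1 := by
    have : (I * J) * (I * J) = I * (J * I) * J := by noncomm_ring
    rw [this, hIJ]
    have : I * -(I * J) * J = -((I * I) * (J * J)) := by noncomm_ring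
    rw [this, hI, hJ]; simp
  have tK : (I * J).trace = 0 := by
    have := Matrix.trace_mul_comm J I
    rw [hIJ, Matrix.trace_neg] at this
    linear_combination (-1/2) * this
  have eIK : I * (I * J) = -J := by rw [← mul_assoc, hI]; simp
  have eJK : J * (I * J) = I := by rw [← mul_assoc, hIJ, neg_mul, mul_assoc, hJ]; simp
  have eKI : (I * J) * I = J := by rw [mul_assoc, hIJ, mul_neg, ← mul_assoc, hI]; simp
  have eKJ : (I * J) * J = -I := by rw [mul_assoc, hJ]; simp
  set K := I * J with hKdef
  set β := n.trace / 2 with hβ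
  set x := -(n * I).trace / 2 with hx
  set y := -(n * J).trace / 2 with hy
  set z := -(n * K).trace / 2 with hz
  have key := m2_scalar hI hJ hIJ (Y := n - β • 1 - x • I - y • J - z • K)
    (by simp [sub_mul, hI, hIJ, eKI, tI, tJ, tK, ← hKdef, hx])
    (by simp [sub_mul, hJ, eKJ, tI, tJ, tK, ← hKdef, hy])
    (by rw [← hKdef]; simp [sub_mul, hK, eIK, eJK, tI, tJ, tK, hz])
  have t0 : (n - β • 1 - x • I - y • J - z • K).trace = 0 := by
    simp [tI, tJ, tK, hβ]
  rw [t0] at key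
  have hn : n = β • 1 + x • I + y • J + z • K := by
    rw [zero_div, zero_smul] at key
    rw [sub_sub, sub_sub, sub_sub, sub_eq_zero] at key
    rw [key]; abel
  have h2 : 2 * n.trace = 4 * β := by rw [hβ]; ring
  clear_value β x y z
  rw [h2, hn]
  clear hn key t0 hx hy hz hβ h2
  simp only [mul_add, add_mul, mul_smul_comm, smul_mul_assoc, mul_one, hI, hJ, hIJ, hK, eIK,
    eJK, eKI, eKJ, neg_mul, ← hKdef, mul_neg, one_mul, neg_neg, smul_neg]
  module

lemma m2_det_dyn (x κ : Matrix (Fin 2) (Fin 2) L) (h0 : κ.trace = 0) (h1 : κ.det = 1) :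
    (1 + x.adjugate * (κ - 1) * x).det = 1 - 2 * x.det + 2 * x.det ^ 2 := by
  rw [Matrix.adjugate_fin_two]
  simp only [Matrix.det_fin_two, Matrix.trace_fin_two, Matrix.mul_apply, Fin.sum_univ_two,
    Matrix.add_apply, Matrix.sub_apply, Matrix.one_apply, Matrix.of_apply, Matrix.cons_val',
    Matrix.cons_val_zero, Matrix.cons_val_one, Matrix.cons_val_fin_one] at *
  simp only [if_true, if_false, Fin.reduceEq, Fin.isValue] at *
  have e : κ 1 1 = -κ 0 0 := by linear_combination h0
  rw [e] at h1 ⊢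
  linear_combination (x 0 0 * x 1 1 - x 0 1 * x 1 0)^2 * h1

lemma m2_det_three (α : Matrix (Fin 2) (Fin 2) L) (lam : L) (h0 : α.trace = -1) (h1 : α.det = 1) :
    (1 + lam • (α - 1)).det = 1 - 3 * lam + 3 * lam ^ 2 := by
  simp only [Matrix.det_fin_two, Matrix.trace_fin_two, 
    Matrix.add_apply, Matrix.sub_apply, Matrix.one_apply, Matrix.smul_apply, smul_eq_mul] at *
  simp only [if_true, if_false, Fin.reduceEq, Fin.isValue] at *
  linear_combination lam ^ 2 * h1 + (lam - lam ^ 2) * h0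

lemma m2_det_half (κ κ' : Matrix (Fin 2) (Fin 2) L) (h0 : κ.trace = 0) (h1 : κ.det = 1)
    (h0' : κ'.trace = 0) (h1' : κ'.det = 1) :
    (κ - κ' - 1 - κ' * κ).det = 4 + 2 * (κ * κ').trace := by
  simp only [Matrix.det_fin_two, Matrix.trace_fin_two, Matrix.mul_apply, Fin.sum_univ_two,
    Matrix.add_apply, Matrix.sub_apply, Matrix.one_apply, Matrix.smul_apply, smul_eq_mul] at *
  simp only [if_true, if_false, Fin.reduceEq, Fin.isValue] at *
  have e : κ 1 1 = -κ 0 0 := by linear_combination h0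
  have e' : κ' 1 1 = -κ' 0 0 := by linear_combination h0'
  rw [e] at h1 ⊢
  rw [e'] at h1' ⊢
  linear_combination (1 + (-κ' 0 0 * κ' 0 0 - κ' 0 1 * κ' 1 0)) * h1 + 2 * h1'
end TwoByTwo


/-! ### The characteristic zero part -/

section CharZeroPart

/-- Sums of two roots of unity equal to `2`. -/
lemma roots_sum_two {L : Type*} [Field L] [CharZero L] {x y : L} {N : ℕ} (hN : 0 < N)
    (hx : x ^ N = 1) (hy : y ^ N = 1) (h : x + y = 2) : x = 1 := by
  have hxint : IsIntegral ℚ x :=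
    ⟨Polynomial.X ^ N - 1, Polynomial.monic_X_pow_sub_C 1 hN.ne', by simp [hx]⟩
  have : Algebra.IsAlgebraic ℚ (IntermediateField.adjoin ℚ {x}) :=
    IntermediateField.isAlgebraic_adjoin_simple hxint
  let φ : (IntermediateField.adjoin ℚ {x}) →ₐ[ℚ] ℂ := IsAlgClosed.lift
  let x' : IntermediateField.adjoin ℚ {x} := ⟨x, IntermediateField.mem_adjoin_simple_self ℚ x⟩
  have hx' : x' ^ N = 1 := by
    apply Subtype.ext; simpa using hx
  have hy' : (1 + 1 - x') ^ N = 1 := by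
    apply Subtype.ext
    have : y = 1 + 1 - x := by linear_combination h
    rw [this] at hy
    exact hy
  have h1 : ‖φ x'‖ = 1 := by
    apply Complex.norm_eq_one_of_pow_eq_one (n := N) _ hN.ne'
    rw [← map_pow, hx', map_one]
  have h2 : ‖2 - φ x'‖ = 1 := by
    apply Complex.norm_eq_one_of_pow_eq_one (n := N) _ hN.ne'
    have : (2 : ℂ) - φ x' = φ (1 + 1 - x') := by
      rw [map_sub, map_add, map_one]; norm_num
    rw [this, ← map_pow, hy', map_one]
  have h3 : φ x' = 1 := by
    have e1 : Complex.normSq (φ x') = 1 := by rw [Complex.normSq_eq_norm_sq, h1]; norm_num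
    have e2 : Complex.normSq (2 - φ x') = 1 := by rw [Complex.normSq_eq_norm_sq, h2]; norm_num
    rw [Complex.normSq_apply] at e1 e2
    simp at e2
    have hre : (φ x').re = 1 := by nlinarith
    have him : (φ x').im = 0 := by
      rw [hre] at e1
      nlinarith [mul_self_eq_zero.mp (by linarith : (φ x').im * (φ x').im = 0)]
    exact Complex.ext (by simp [hre]) (by simp [him])
  have h4 : x' = 1 := φ.toRingHom.injective (by
    change φ x' = φ 1
    rw [h3, map_one])
  simpa [x'] using congrArg Subtype.val h4

lemma root_of_unity_mid {L : Type*} [Field L] [CharZero L] {μ ν c : L} {N M : ℕ} (hN : 0 < N)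
    (hM : 0 < M) (hμ : μ ^ N = 1) (hμν : μ * ν = 1) (hc : c ^ M = 1) (h : μ + ν = 2 * c) :
    c ^ 2 = 1 := by
  have hc0 : c ≠ 0 := by rintro rfl; simp [hM.ne'] at hc
  have hν : ν ^ N = 1 := by
    have : (μ * ν) ^ N = 1 := by rw [hμν, one_pow]
    rwa [mul_pow, hμ, one_mul] at this
  have h1 := roots_sum_two (x := μ / c) (y := ν / c) (N := N * M) (by positivity)
    (by rw [div_pow, pow_mul, hμ, mul_comm N M, pow_mul, hc]; simp)
    (by rw [div_pow, pow_mul, hν, mul_comm N M, pow_mul, hc]; simp)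
    (by field_simp; linear_combination h)
  have h2 : μ = c := by field_simp at h1; exact h1
  subst h2
  have : ν = μ := by linear_combination h
  rw [this] at hμν
  rw [sq, hμν]

lemma pow_two_dyn {L : Type*} [Field L] [CharZero L] {S : Set L} (hS : S.Finite)
    (hsq : ∀ c ∈ S, c ^ 2 ∈ S) {c : L} (hc : c ∈ S) (hc0 : c ≠ 0) : ∃ M, 0 < M ∧ c ^ M = 1 := by
  have hmem : ∀ k : ℕ, c ^ (2 ^ k) ∈ S := by
    intro k
    induction k with
    | zero => simpa using hc
    | succ k ih => rw [pow_succ, pow_mul]; exact hsq _ ih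
  obtain ⟨a, -, b, -, hab, h⟩ := Set.infinite_univ.exists_ne_map_eq_of_mapsTo
    (f := fun k : ℕ => c ^ (2 ^ k)) (t := S) (fun k _ => hmem k) hS
  wlog hlt : a < b generalizing a b
  · exact this b a hab.symm h.symm (by omega)
  have h2 : 2 ^ a < 2 ^ b := Nat.pow_lt_pow_right (by norm_num) hlt
  refine ⟨2 ^ b - 2 ^ a, by omega, ?_⟩
  have h3 : c ^ (2 ^ b) = c ^ (2 ^ a) * c ^ (2 ^ b - 2 ^ a) := by
    rw [← pow_add]; congr 1; omega
  have h' : c ^ (2 ^ a) = c ^ (2 ^ b) := h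
  rw [← h'] at h3
  exact (mul_eq_left₀ (pow_ne_zero _ hc0)).mp h3.symm

/-- A unipotent element of finite order in characteristic zero is trivial. -/
lemma unipotent_finite_order {L A : Type*} [Field L] [CharZero L] [Ring A] [Algebra L A] {g : A}
    {N k : ℕ} (hN : 0 < N) (hg : g ^ N = 1) (hn : (g - 1) ^ k = 0) : g = 1 := by
  obtain ⟨n, rfl⟩ : ∃ n, g = 1 + n := ⟨g - 1, by abel⟩
  rw [add_sub_cancel_left] at hn
  have key : ∀ l : ℕ, n ^ (l + 1) = 0 → n = 0 := by
    intro l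
    induction l with
    | zero => intro h; simpa using h
    | succ l ih =>
      intro h
      apply ih
      have h1 : ∀ M : ℕ, n ^ l * (1 + n) ^ M = n ^ l + (M : L) • n ^ (l + 1) := by
        intro M
        induction M with
        | zero => simp
        | succ M ihM =>
          rw [pow_succ, ← mul_assoc, ihM, mul_add, mul_one, add_mul, smul_mul_assoc,
            ← pow_succ, ← pow_succ, h, smul_zero, add_zero]
          push_cast
          rw [add_smul, one_smul]
          abel
      have h2 := h1 N
      rw [hg, mul_one, left_eq_add] at h2
      rcases smul_eq_zero.mp h2 with h3 | h3
      · exact absurd h3 (by exact_mod_cast hN.ne')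
      · exact h3
  have : n = 0 := key k (by rw [pow_succ, hn, zero_mul])
  rw [this, add_zero]

end CharZeroPart


section QuatDatum

variable {L : Type*} [Field L] {m : Type*} [Fintype m] [DecidableEq m] {H : Type*} [Group H]

/-- A quaternion group of order eight acting on a plane `im P` (with complement `ker Q`). -/
structure IsQuat (ρ : H →* Matrix m m L) (i j : H) (P : Matrix m (Fin 2) L)
    (Q : Matrix (Fin 2) m L) : Prop where
  hjj : j * j = i * i
  htt : i * i * (i * i) = 1
  hji : j * i = i * i * (i * j)
  QP : Q * P = 1
  PQ : (2 : L) • (P * Q) = 1 - ρ (i * i)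
  hi : ρ i = 1 + P * (Q * ρ i * P - 1) * Q
  hj : ρ j = 1 + P * (Q * ρ j * P - 1) * Q
  inv : ∀ h : H, (ρ h⁻¹).trace = (ρ h).trace

/-- The compression of `ρ h` to the plane. -/
def comprS (ρ : H →* Matrix m m L) (P : Matrix m (Fin 2) L)
    (Q : Matrix (Fin 2) m L) (h : H) : Matrix (Fin 2) (Fin 2) L := Q * ρ h * P

/-- `κ` is a quaternion of order four on the plane. -/
structure IsQuarter (ρ : H →* Matrix m m L) (i : H) (P : Matrix m (Fin 2) L)
    (Q : Matrix (Fin 2) m L) (κ : H) : Prop where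
  sq : κ * κ = i * i
  eq : ρ κ = 1 + P * (comprS ρ P Q κ - 1) * Q
  tr : (comprS ρ P Q κ).trace = 0

lemma refl_mul_P {k : Type*} [Fintype k] [DecidableEq k] {X : Matrix m m L} {P : Matrix m k L}
    {Q : Matrix k m L} (QP : Q * P = 1)
    {Y : Matrix k k L} (h : X = 1 + P * (Y - 1) * Q) : X * P = P * Y := by
  rw [h, Matrix.add_mul, Matrix.mul_assoc _ Q P, QP, Matrix.mul_one, Matrix.one_mul, Matrix.mul_sub, Matrix.mul_one]; abel

lemma Q_mul_refl {k : Type*} [Fintype k] [DecidableEq k] {X : Matrix m m L} {P : Matrix m k L}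
    {Q : Matrix k m L} (QP : Q * P = 1)
    {Y : Matrix k k L} (h : X = 1 + P * (Y - 1) * Q) : Q * X = Y * Q := by
  rw [h, Matrix.mul_add, Matrix.mul_one, ← Matrix.mul_assoc, ← Matrix.mul_assoc, QP, Matrix.one_mul, Matrix.sub_mul, Matrix.one_mul]; abel

namespace IsQuat

variable {ρ : H →* Matrix m m L} {i j : H} {P : Matrix m (Fin 2) L} {Q : Matrix (Fin 2) m L}

lemma rtP [CharZero L] (D : IsQuat ρ i j P Q) : ρ (i * i) * P = -P := by
  have h : ρ (i * i) = 1 - (2 : L) • (P * Q) := by rw [D.PQ]; abel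
  rw [h, Matrix.sub_mul, Matrix.one_mul, Matrix.smul_mul, Matrix.mul_assoc, D.QP, Matrix.mul_one, two_smul]; abel

lemma Qrt [CharZero L] (D : IsQuat ρ i j P Q) : Q * ρ (i * i) = -Q := by
  have h : ρ (i * i) = 1 - (2 : L) • (P * Q) := by rw [D.PQ]; abel
  rw [h, Matrix.mul_sub, Matrix.mul_one, Matrix.mul_smul, ← Matrix.mul_assoc, D.QP, Matrix.one_mul, two_smul]; abel

lemma S_one (D : IsQuat ρ i j P Q) : comprS ρ P Q 1 = 1 := by
  simp [comprS, D.QP]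

lemma S_mul_t [CharZero L] (D : IsQuat ρ i j P Q) (h : H) :
    comprS ρ P Q (h * (i * i)) = - comprS ρ P Q h := by
  rw [comprS, comprS, map_mul, Matrix.mul_assoc, Matrix.mul_assoc, D.rtP]; simp [Matrix.mul_assoc]

lemma S_t_mul [CharZero L] (D : IsQuat ρ i j P Q) (h : H) :
    comprS ρ P Q (i * i * h) = - comprS ρ P Q h := by
  rw [comprS, comprS, map_mul, ← Matrix.mul_assoc Q, D.Qrt]; simp

lemma S_mul_right (D : IsQuat ρ i j P Q) {κ : H}
    (hκ : ρ κ = 1 + P * (comprS ρ P Q κ - 1) * Q) (h : H) :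
    comprS ρ P Q (h * κ) = comprS ρ P Q h * comprS ρ P Q κ := by
  have := refl_mul_P D.QP hκ
  rw [comprS, map_mul, Matrix.mul_assoc, Matrix.mul_assoc, this]
  simp only [comprS, Matrix.mul_assoc]

lemma S_mul_left (D : IsQuat ρ i j P Q) {κ : H}
    (hκ : ρ κ = 1 + P * (comprS ρ P Q κ - 1) * Q) (h : H) :
    comprS ρ P Q (κ * h) = comprS ρ P Q κ * comprS ρ P Q h := by
  have := Q_mul_refl D.QP hκ
  rw [comprS, map_mul, ← Matrix.mul_assoc, this, comprS, comprS]; simp [Matrix.mul_assoc]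

lemma S_t [CharZero L] (D : IsQuat ρ i j P Q) : comprS ρ P Q (i * i) = -1 := by
  have := D.S_mul_t 1
  rwa [one_mul, D.S_one] at this

lemma II [CharZero L] (D : IsQuat ρ i j P Q) :
    comprS ρ P Q i * comprS ρ P Q i = -1 := by
  rw [← D.S_mul_right D.hi, D.S_t]

lemma JJ [CharZero L] (D : IsQuat ρ i j P Q) :
    comprS ρ P Q j * comprS ρ P Q j = -1 := by
  rw [← D.S_mul_right D.hj, D.hjj, D.S_t]

lemma JI [CharZero L] (D : IsQuat ρ i j P Q) :
    comprS ρ P Q j * comprS ρ P Q i = -(comprS ρ P Q i * comprS ρ P Q j) := by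
  rw [← D.S_mul_right D.hi, D.hji, D.S_t_mul, D.S_mul_right D.hj]

lemma quarter_i [CharZero L] (D : IsQuat ρ i j P Q) : IsQuarter ρ i P Q i :=
  ⟨rfl, D.hi, m2_trace_zero_of_anticomm D.II D.JJ D.JI⟩

lemma quarter_j [CharZero L] (D : IsQuat ρ i j P Q) : IsQuarter ρ i P Q j :=
  ⟨D.hjj, D.hj, m2_trace_zero_of_anticomm D.JJ D.II (by rw [D.JI]; simp)⟩

lemma quarter_k [CharZero L] (D : IsQuat ρ i j P Q) : IsQuarter ρ i P Q (i * j) := by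
  have hji := D.hji
  have hjj := D.hjj
  have htt := D.htt
  refine ⟨?_, ?_, ?_⟩
  · calc i * j * (i * j) = i * (j * i) * j := by group
      _ = i * i * (i * i) * (j * j) := by rw [hji]; simp only [mul_assoc]
      _ = i * i := by rw [htt, hjj, one_mul]
  · rw [D.S_mul_right D.hj, map_mul]
    have e1 := refl_mul_P D.QP D.hi
    change ρ i * P = P * comprS ρ P Q i at e1
    have e2 : ρ j = 1 + P * (comprS ρ P Q j - 1) * Q := D.hj
    have e3 : ρ i = 1 + P * (comprS ρ P Q i - 1) * Q := D.hi
    rw [e2, Matrix.mul_add, Matrix.mul_one, ← Matrix.mul_assoc, ← Matrix.mul_assoc, e1, e3]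
    simp only [Matrix.mul_sub, Matrix.sub_mul, Matrix.mul_one, Matrix.mul_assoc]; abel
  · have h : (comprS ρ P Q (i * j)).trace = - (comprS ρ P Q (i * j)).trace := by
      conv_lhs => rw [D.S_mul_right D.hj, Matrix.trace_mul_comm, D.JI, trace_neg,
        ← D.S_mul_right D.hj]
    have : (2 : L) * (comprS ρ P Q (i * j)).trace = 0 := by linear_combination h
    simpa using this

lemma trS [CharZero L] (D : IsQuat ρ i j P Q) (h : H) :
    2 * (comprS ρ P Q h).trace = (ρ h).trace - (ρ (h * (i * i))).trace := by
  rw [comprS, Matrix.trace_mul_comm, ← Matrix.mul_assoc, ← smul_eq_mul, ← trace_smul, ← Matrix.smul_mul,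
    D.PQ, Matrix.sub_mul, Matrix.one_mul, trace_sub, Matrix.trace_mul_comm, map_mul ρ h]

lemma trS_inv [CharZero L] (D : IsQuat ρ i j P Q) (h : H) :
    (comprS ρ P Q h⁻¹).trace = (comprS ρ P Q h).trace := by
  have e1 := D.trS h
  have e2 := D.trS h⁻¹
  have e3 : (ρ (h⁻¹ * (i * i))).trace = (ρ (h * (i * i))).trace := by
    rw [← D.inv]
    have : (h⁻¹ * (i * i))⁻¹ = (i * i) * h := by
      rw [_root_.mul_inv_rev, inv_inv, inv_eq_of_mul_eq_one_right D.htt]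
    rw [this, map_mul, Matrix.trace_mul_comm, ← map_mul]
  rw [D.inv, e3, ← e1] at e2
  exact mul_left_cancel₀ two_ne_zero e2

lemma quarter_inv (D : IsQuat ρ i j P Q) {κ : H} (hκ : IsQuarter ρ i P Q κ) :
    κ⁻¹ = i * i * κ := by
  apply inv_eq_of_mul_eq_one_left
  rw [mul_assoc, hκ.sq, D.htt]

lemma quarter_inv' (D : IsQuat ρ i j P Q) {κ : H} (hκ : IsQuarter ρ i P Q κ) :
    κ⁻¹ = κ * (i * i) := by
  apply inv_eq_of_mul_eq_one_right
  rw [← mul_assoc, hκ.sq, D.htt]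

lemma quarter_quarter_inv [CharZero L] (D : IsQuat ρ i j P Q) {κ : H}
    (hκ : IsQuarter ρ i P Q κ) : IsQuarter ρ i P Q κ⁻¹ := by
  have hS : comprS ρ P Q κ⁻¹ = - comprS ρ P Q κ := by rw [D.quarter_inv' hκ, D.S_mul_t]
  refine ⟨?_, ?_, ?_⟩
  · rw [←  _root_.mul_inv_rev, hκ.sq]; exact inv_eq_of_mul_eq_one_right D.htt
  · have h : ρ (i * i) = 1 - (2 : L) • (P * Q) := by rw [D.PQ]; abel
    rw [hS, D.quarter_inv' hκ, map_mul, h, Matrix.mul_sub, Matrix.mul_one, Matrix.mul_smul, ← Matrix.mul_assoc,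
      refl_mul_P D.QP hκ.eq, hκ.eq, two_smul]
    simp only [Matrix.mul_sub, Matrix.sub_mul, Matrix.mul_one, Matrix.mul_assoc, Matrix.mul_neg, Matrix.neg_mul]; abel
  · rw [hS, trace_neg, hκ.tr, neg_zero]

lemma tr_aux [CharZero L] (D : IsQuat ρ i j P Q) {κ : H} (hκ : IsQuarter ρ i P Q κ) (h : H) :
    ((comprS ρ P Q h + comprS ρ P Q h⁻¹) * comprS ρ P Q κ).trace = 0 := by
  rw [add_mul, ← D.S_mul_right hκ.eq, ← D.S_mul_right hκ.eq, trace_add, ← D.trS_inv (h⁻¹ * κ),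
     _root_.mul_inv_rev, inv_inv, D.quarter_inv hκ, mul_assoc, D.S_t_mul, D.S_mul_left hκ.eq,
    D.S_mul_right hκ.eq, trace_neg, Matrix.trace_mul_comm]
  ring

lemma S_inv [CharZero L] (D : IsQuat ρ i j P Q) (h : H) :
    comprS ρ P Q h⁻¹ = (comprS ρ P Q h).adjugate := by
  have key := m2_scalar D.II D.JJ D.JI (D.tr_aux D.quarter_i h) (D.tr_aux D.quarter_j h)
    (by rw [← D.S_mul_right D.hj]; exact D.tr_aux D.quarter_k h)
  rw [trace_add, D.trS_inv] at key
  have e : comprS ρ P Q h⁻¹ = (comprS ρ P Q h).trace • 1 - comprS ρ P Q h := by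
    rw [eq_sub_iff_add_eq, add_comm, key]; congr 1; ring
  rw [e, adjugate_fin_two]
  ext a b
  fin_cases a <;> fin_cases b <;> simp [trace_fin_two]

lemma S_conj (D : IsQuat ρ i j P Q) {κ : H} (hκ : IsQuarter ρ i P Q κ) (g : H) :
    comprS ρ P Q (g⁻¹ * κ * g) =
      1 + comprS ρ P Q g⁻¹ * (comprS ρ P Q κ - 1) * comprS ρ P Q g := by
  have h1 : Q * ρ g⁻¹ * ρ g * P = 1 := by
    rw [Matrix.mul_assoc Q, ← map_mul, inv_mul_cancel, map_one, Matrix.mul_one, D.QP]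
  rw [comprS, map_mul, map_mul, hκ.eq]
  generalize comprS ρ P Q κ - 1 = Z
  rw [← h1]
  simp only [comprS, Matrix.mul_add, Matrix.add_mul, Matrix.mul_assoc, Matrix.mul_one]

lemma quarter_det [CharZero L] (D : IsQuat ρ i j P Q) {κ : H} (hκ : IsQuarter ρ i P Q κ) :
    (comprS ρ P Q κ).det = 1 :=
  m2_det_one (by rw [← D.S_mul_right hκ.eq, hκ.sq, D.S_t]) hκ.tr

lemma lam_conj [CharZero L] (D : IsQuat ρ i j P Q) (g : H) :
    (comprS ρ P Q (g⁻¹ * i * g)).det =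
      1 - 2 * (comprS ρ P Q g).det + 2 * (comprS ρ P Q g).det ^ 2 := by
  rw [D.S_conj D.quarter_i, D.S_inv]
  exact m2_det_dyn _ _ D.quarter_i.tr (D.quarter_det D.quarter_i)

lemma P_ne (D : IsQuat ρ i j P Q) : P ≠ 0 := by
  rintro rfl
  have := D.QP
  rw [Matrix.mul_zero] at this
  exact zero_ne_one this

end IsQuat

end QuatDatum


set_option linter.unusedSectionVars false

section QuatDatum2

variable {L : Type*} [Field L] [CharZero L] {m : Type*} [Fintype m] [DecidableEq m]
  {H : Type*} [Group H]

namespace IsQuat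

variable {ρ : H →* Matrix m m L} {i j : H} {P : Matrix m (Fin 2) L} {Q : Matrix (Fin 2) m L}

lemma rho_t (D : IsQuat ρ i j P Q) : ρ (i * i) = 1 - (2 : L) • (P * Q) := by
  rw [D.PQ]; abel

lemma S_mul_S_inv (D : IsQuat ρ i j P Q) (g : H) :
    comprS ρ P Q g * comprS ρ P Q g⁻¹ = (comprS ρ P Q g).det • 1 := by
  rw [D.S_inv, mul_adjugate]

lemma S_inv_mul_S (D : IsQuat ρ i j P Q) (g : H) :
    comprS ρ P Q g⁻¹ * comprS ρ P Q g = (comprS ρ P Q g).det • 1 := by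
  rw [D.S_inv, adjugate_mul]

/-- the product of the two involutions `t` and `g t g⁻¹` acts quadratically -/
lemma two_inv (D : IsQuat ρ i j P Q) (g : H) :
    ρ (i * i * (g * (i * i) * g⁻¹)) * P + ρ (g * (i * i) * g⁻¹ * (i * i)) * P =
      (2 * (2 * (comprS ρ P Q g).det - 1)) • P := by
  have hE : ρ (g * (i * i) * g⁻¹) = 1 - (2 : L) • (ρ g * P * (Q * ρ g⁻¹)) := by
    rw [map_mul, map_mul, D.rho_t, mul_sub, mul_one, sub_mul, ← map_mul, mul_inv_cancel, map_one]
    simp [Matrix.mul_assoc]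
  have h1 : P * Q * (ρ g * P * (Q * ρ g⁻¹)) * P = (comprS ρ P Q g).det • P := by
    have := congrArg (fun X => P * X) (D.S_mul_S_inv g)
    simpa [comprS, Matrix.mul_assoc] using this
  rw [map_mul, map_mul ρ (g * (i * i) * g⁻¹), Matrix.mul_assoc _ _ P, Matrix.mul_assoc _ _ P,
    D.rtP, hE, D.rho_t]
  have e : (1 - (2 : L) • (P * Q)) * ((1 - (2 : L) • (ρ g * P * (Q * ρ g⁻¹))) * P) +
      (1 - (2 : L) • (ρ g * P * (Q * ρ g⁻¹))) * -P =
      (4 : L) • (P * Q * (ρ g * P * (Q * ρ g⁻¹)) * P) - (2 : L) • (P * (Q * P)) := by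
    simp only [Matrix.sub_mul, Matrix.mul_sub, Matrix.one_mul, Matrix.mul_neg,
      Matrix.smul_mul, Matrix.mul_smul, smul_sub, Matrix.mul_assoc, smul_smul]
    norm_num
    abel
  rw [e, h1, D.QP, Matrix.mul_one, smul_smul, ← sub_smul]
  congr 1; ring

lemma root_of_smul {g : Matrix m m L} {N : ℕ} (hg : g ^ N = 1) {μ : L} {W : Matrix m (Fin 2) L}
    (hW : W ≠ 0) (h : g * W = μ • W) : μ ^ N = 1 := by
  have h1 : ∀ M : ℕ, g ^ M * W = μ ^ M • W := by
    intro M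
    induction M with
    | zero => simp
    | succ M ih =>
      rw [pow_succ, Matrix.mul_assoc, h, Matrix.mul_smul, ih, smul_smul, pow_succ, mul_comm]
  have h2 := h1 N
  rw [hg, Matrix.one_mul] at h2
  have h3 : (μ ^ N - 1) • W = 0 := by rw [sub_smul, ← h2, one_smul, sub_self]
  rcases smul_eq_zero.mp h3 with h4 | h4
  · linear_combination h4
  · exact absurd h4 hW

lemma exists_root_of_unity [IsAlgClosed L] [Finite H] (D : IsQuat ρ i j P Q) (g : H) :
    ∃ μ ν : L, ∃ N : ℕ, 0 < N ∧ μ ^ N = 1 ∧ μ * ν = 1 ∧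
      μ + ν = 2 * (2 * (comprS ρ P Q g).det - 1) := by
  set c := 2 * (comprS ρ P Q g).det - 1 with hc
  obtain ⟨μ, hμ⟩ : ∃ μ : L, μ * μ - 2 * c * μ + 1 = 0 := by
    have hd : (Polynomial.C 1 * Polynomial.X ^ 2 + Polynomial.C (-(2 * c)) * Polynomial.X
        + Polynomial.C 1 : Polynomial L).degree = 2 := Polynomial.degree_quadratic one_ne_zero
    obtain ⟨μ, h⟩ := IsAlgClosed.exists_root _ (by rw [hd]; norm_num)
    refine ⟨μ, ?_⟩
    have h' : 1 * μ ^ 2 + -(2 * c) * μ + 1 = 0 := by simpa [Polynomial.IsRoot.def] using h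
    linear_combination h'
  set x : H := i * i * (g * (i * i) * g⁻¹) with hx
  have hxi : g * (i * i) * g⁻¹ * (i * i) = x⁻¹ := by
    apply eq_inv_of_mul_eq_one_left
    have htt := D.htt
    calc _ = g * (i * i) * g⁻¹ * (i * i * (i * i)) * (g * (i * i) * g⁻¹) := by
            rw [hx]; simp only [mul_assoc]
      _ = g * (i * i * (i * i)) * g⁻¹ := by
            nth_rewrite 1 [htt]; group
      _ = 1 := by rw [htt]; simp
  have h1 : ρ x * P + ρ x⁻¹ * P = (2 * c) • P := by
    rw [← hxi]; exact D.two_inv g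
  have h2 : ρ x * (ρ x * P) + P = (2 * c) • (ρ x * P) := by
    have := congrArg (fun X => ρ x * X) h1
    simp only [Matrix.mul_add, Matrix.mul_smul] at this
    rwa [← Matrix.mul_assoc (ρ x) (ρ x⁻¹), ← map_mul, mul_inv_cancel, map_one,
      Matrix.one_mul] at this
  have hN : 0 < orderOf x := orderOf_pos x
  have hxN : ρ x ^ orderOf x = 1 := by rw [← map_pow, pow_orderOf_eq_one, map_one]
  have hμν : μ * (2 * c - μ) = 1 := by linear_combination -hμ
  by_cases hW : ρ x * P - μ • P = 0
  · refine ⟨μ, 2 * c - μ, orderOf x, hN, ?_, hμν, by ring⟩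
    exact root_of_smul hxN D.P_ne (sub_eq_zero.mp hW)
  · refine ⟨2 * c - μ, μ, orderOf x, hN, ?_, by rw [mul_comm]; exact hμν, by ring⟩
    refine root_of_smul hxN hW ?_
    rw [Matrix.mul_sub, Matrix.mul_smul, smul_sub, smul_smul, mul_comm _ μ, hμν, one_smul, sub_smul,
      ← h2]
    abel

/-- The possible values of `lam`. -/
lemma lam_mem [IsAlgClosed L] [Finite H] (D : IsQuat ρ i j P Q) (g : H) :
    (comprS ρ P Q g).det = 0 ∨ (comprS ρ P Q g).det = 1 / 2 ∨ (comprS ρ P Q g).det = 1 := by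
  obtain ⟨μ, ν, N, hN, hμ, hμν, h⟩ := D.exists_root_of_unity g
  by_cases hc : 2 * (comprS ρ P Q g).det - 1 = 0
  · right; left; linear_combination hc / 2
  · obtain ⟨M, hM, hcM⟩ := pow_two_dyn
      (S := Set.range fun g : H => 2 * (comprS ρ P Q g).det - 1) (Set.finite_range _)
      (by
        rintro _ ⟨g, rfl⟩
        refine ⟨g⁻¹ * i * g, ?_⟩
        simp only [D.lam_conj]; ring) ⟨g, rfl⟩ hc
    have := root_of_unity_mid hN hM hμ hμν hcM h
    have h2 : (comprS ρ P Q g).det * ((comprS ρ P Q g).det - 1) = 0 := by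
      linear_combination this / 4
    rcases mul_eq_zero.mp h2 with h3 | h3
    · exact Or.inl h3
    · right; right; linear_combination h3

end IsQuat

end QuatDatum2


set_option linter.unusedSectionVars false

section TriDatum

variable {L : Type*} [Field L] {m : Type*} [Fintype m] [DecidableEq m]
  {H : Type*} [Group H]

/-- An element of order three acting on a plane, trivially on a complement. -/
structure IsTri (ρ : H →* Matrix m m L) (a : H) (P : Matrix m (Fin 2) L)
    (Q : Matrix (Fin 2) m L) : Prop where
  haaa : a * a * a = 1
  QP : Q * P = 1
  PQ : (3 : L) • (P * Q) = (3 : L) • 1 - (1 + ρ a + ρ (a * a))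
  inv : (ρ a⁻¹).trace = (ρ a).trace

variable [CharZero L]

lemma m2_ch (x : Matrix (Fin 2) (Fin 2) L) : x * x = x.trace • x - x.det • 1 := by
  ext a b
  fin_cases a <;> fin_cases b <;> simp [mul_apply, Fin.sum_univ_two, trace_fin_two, det_fin_two]
    <;> ring

lemma m2_adj (x : Matrix (Fin 2) (Fin 2) L) : x.adjugate = x.trace • 1 - x := by
  rw [adjugate_fin_two]
  ext a b
  fin_cases a <;> fin_cases b <;> simp [trace_fin_two]

lemma m2_rank_one (x k : Matrix (Fin 2) (Fin 2) L) (h : x.det = 0) :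
    x * k * x = (x * k).trace • x := by
  rw [det_fin_two] at h
  ext a b
  fin_cases a <;> fin_cases b <;> simp [mul_apply, Fin.sum_univ_two, trace_fin_two]
  · linear_combination (-k 1 1) * h
  · linear_combination (k 0 1) * h
  · linear_combination (k 1 0) * h
  · linear_combination (-k 0 0) * h

lemma m2_det_lin (x : Matrix (Fin 2) (Fin 2) L) (s t : L) :
    (s • (1 : Matrix (Fin 2) (Fin 2) L) + t • x).det = s ^ 2 + s * t * x.trace + t ^ 2 * x.det := by
  simp [det_fin_two, trace_fin_two]; ring

namespace IsTri

variable {ρ : H →* Matrix m m L} {a : H} {P : Matrix m (Fin 2) L} {Q : Matrix (Fin 2) m L}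

lemma eq (D : IsTri ρ a P Q) : ρ a = 1 + P * (Q * ρ a * P - 1) * Q := by
  have h3 : (3 : L) ≠ 0 := by norm_num
  have hr : ρ a * ρ (a * a) = 1 := by rw [← map_mul, ← mul_assoc, D.haaa, map_one]
  have hr' : ρ (a * a) * ρ a = 1 := by rw [← map_mul, D.haaa, map_one]
  have e1 : ρ a * (P * Q) = P * Q * ρ a := by
    apply smul_right_injective _ h3
    change (3 : L) • (ρ a * (P * Q)) = (3 : L) • (P * Q * ρ a)
    rw [← Matrix.mul_smul, ← Matrix.smul_mul (3 : L) (P * Q), D.PQ]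
    simp only [mul_sub, sub_mul, mul_add, add_mul, hr, hr', Matrix.mul_smul, Matrix.smul_mul,
      mul_one, one_mul]
  have e2 : ρ a - ρ a * (P * Q) = 1 - P * Q := by
    apply smul_right_injective _ h3
    change (3 : L) • (ρ a - ρ a * (P * Q)) = (3 : L) • (1 - P * Q)
    rw [smul_sub, smul_sub, ← Matrix.mul_smul, D.PQ]
    simp only [mul_sub, mul_add, hr, Matrix.mul_smul, mul_one]
    rw [map_mul]; abel
  have e3 : P * (Q * ρ a * P) * Q = ρ a * (P * Q) := by
    calc P * (Q * ρ a * P) * Q = P * Q * ρ a * (P * Q) := by simp only [Matrix.mul_assoc]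
      _ = ρ a * (P * (Q * P) * Q) := by rw [← e1]; simp only [Matrix.mul_assoc]
      _ = ρ a * (P * Q) := by rw [D.QP, Matrix.mul_one]
  rw [Matrix.mul_sub, Matrix.sub_mul, e3, Matrix.mul_one]
  rw [sub_eq_iff_eq_add] at e2
  calc ρ a = 1 - P * Q + ρ a * (P * Q) := e2
    _ = _ := by abel

lemma alpha_sq (D : IsTri ρ a P Q) :
    (Q * ρ a * P) * (Q * ρ a * P) = - (Q * ρ a * P) - 1 := by
  have h1 := refl_mul_P D.QP D.eq
  have h2 : (Q * ρ a * P) * (Q * ρ a * P) = Q * ρ (a * a) * P := by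
    rw [map_mul]
    calc _ = Q * ρ a * (P * (Q * ρ a * P)) := by simp only [Matrix.mul_assoc]
      _ = _ := by rw [← h1]; simp only [Matrix.mul_assoc]
  have h3 : ρ (a * a) = (3 : L) • 1 - (3 : L) • (P * Q) - 1 - ρ a := by rw [D.PQ]; abel
  rw [h2, h3]
  simp only [Matrix.mul_sub, Matrix.sub_mul, Matrix.mul_smul, Matrix.smul_mul, Matrix.mul_one,
    D.QP]
  have : Q * (P * Q) * P = 1 := by
    rw [← Matrix.mul_assoc, D.QP, Matrix.one_mul, D.QP]
  rw [this]
  abel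

lemma alpha_tr (D : IsTri ρ a P Q) : (Q * ρ a * P).trace = -1 := by
  have hinv : a⁻¹ = a * a := inv_eq_of_mul_eq_one_left D.haaa
  have e1 : (ρ a).trace = (1 : Matrix m m L).trace + ((Q * ρ a * P).trace - 2) := by
    conv_lhs => rw [D.eq]
    rw [trace_add, Matrix.trace_mul_comm, ← Matrix.mul_assoc, D.QP, Matrix.one_mul, trace_sub]
    simp
  have e2 := congrArg Matrix.trace D.PQ
  have e3 : (P * Q).trace = 2 := by
    rw [Matrix.trace_mul_comm, D.QP]; simp
  have e4 := D.inv
  rw [hinv] at e4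
  rw [trace_smul, e3, trace_sub, trace_add, trace_add, trace_smul, e4] at e2
  simp only [smul_eq_mul] at e2
  linear_combination (1/2 : L) * e2 - e1

lemma alpha_det (D : IsTri ρ a P Q) : (Q * ρ a * P).det = 1 := by
  have h1 := m2_ch (Q * ρ a * P)
  rw [D.alpha_sq, D.alpha_tr] at h1
  have h2 : ((Q * ρ a * P).det - 1) • (1 : Matrix (Fin 2) (Fin 2) L) = 0 := by
    rw [sub_smul, one_smul, ← sub_eq_zero.mpr h1]
    simp only [neg_smul, one_smul]; abel_nf
  have h3 := congrFun (congrFun h2 0) 0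
  simp at h3
  linear_combination h3

end IsTri

end TriDatum


set_option linter.unusedSectionVars false

section CZero

variable {L : Type*} [Field L] [CharZero L] [IsAlgClosed L] {m : Type*} [Fintype m] [DecidableEq m]
  {H : Type*} [Group H] [Finite H]
  {ρ : H →* Matrix m m L} {i j : H} {P : Matrix m (Fin 2) L} {Q : Matrix (Fin 2) m L}
  {a : H} {P2 : Matrix m (Fin 2) L} {Q2 : Matrix (Fin 2) m L}

/-- a matrix-level expansion used for products -/
lemma S_three (_D : IsQuat ρ i j P Q) {κ : H} (hκ : IsQuarter ρ i P Q κ) (g g' : H) :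
    comprS ρ P Q (g * κ * g') = comprS ρ P Q (g * g') +
      comprS ρ P Q g * (comprS ρ P Q κ - 1) * comprS ρ P Q g' := by
  rw [comprS, map_mul, map_mul, hκ.eq]
  generalize comprS ρ P Q κ - 1 = Z
  simp only [comprS, Matrix.mul_add, Matrix.add_mul, Matrix.mul_assoc, Matrix.mul_one, map_mul]

lemma S_neg (D : IsQuat ρ i j P Q) {κ : H} (hκ : IsQuarter ρ i P Q κ) :
    comprS ρ P Q κ⁻¹ = - comprS ρ P Q κ := by rw [D.quarter_inv' hκ, D.S_mul_t]

/-- the case `lam a = 0` -/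
lemma case_zero (D : IsQuat ρ i j P Q) (haaa : a * a * a = 1)
    (hT : (comprS ρ P Q a).trace ^ 3 = -1) (hd : (comprS ρ P Q a).det = 0) : False := by
  have hinv : a * a = a⁻¹ := eq_inv_of_mul_eq_one_left haaa
  set x := comprS ρ P Q a with hx
  set T := x.trace with hTd
  have hT0 : T ≠ 0 := by rintro h; rw [h] at hT; norm_num at hT
  have hdet : ∀ κ, IsQuarter ρ i P Q κ →
      (comprS ρ P Q (a * κ * a)).det = T ^ 2 * ((x * comprS ρ P Q κ).trace - T) := by
    intro κ hκ
    rw [S_three D hκ, hinv, D.S_inv, m2_adj]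
    have e : x.trace • (1 : Matrix (Fin 2) (Fin 2) L) - x + x * (comprS ρ P Q κ - 1) * x =
        T • 1 + ((x * comprS ρ P Q κ).trace - T - 1) • x := by
      rw [mul_sub, sub_mul, mul_one, m2_rank_one _ _ hd, m2_ch, hd, sub_smul, sub_smul]
      simp only [zero_smul, one_smul]
      abel
    rw [← hx, e, m2_det_lin, hd, ← hTd]
    ring
  have hz : ∀ κ, IsQuarter ρ i P Q κ → (x * comprS ρ P Q κ).trace = 0 := by
    intro κ hκ
    have e1 := hdet κ hκ
    have e2 := hdet κ⁻¹ (D.quarter_quarter_inv hκ)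
    rw [S_neg D hκ, mul_neg, trace_neg] at e2
    have hs : (comprS ρ P Q (a * κ * a)).det + (comprS ρ P Q (a * κ⁻¹ * a)).det = 2 := by
      rw [e1, e2]; linear_combination (-2) * hT
    have hT2 : T ^ 2 ≠ 0 := pow_ne_zero _ hT0
    have : T ^ 2 * (x * comprS ρ P Q κ).trace = 0 := by
      have e4 : 2 * (T ^ 2 * (x * comprS ρ P Q κ).trace) = (comprS ρ P Q (a * κ * a)).det -
        (comprS ρ P Q (a * κ⁻¹ * a)).det := by rw [e1, e2]; ring
      rcases D.lam_mem (a * κ * a) with h | h | h <;>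
      rcases D.lam_mem (a * κ⁻¹ * a) with h' | h' | h' <;> rw [h, h'] at hs <;>
      first
        | (exfalso; norm_num at hs; done)
        | (rw [h, h'] at e4; linear_combination e4 / 2)
    exact (mul_eq_zero.mp this).resolve_left hT2
  have hs := m2_scalar D.II D.JJ D.JI (hz _ D.quarter_i) (hz _ D.quarter_j)
    (by rw [← D.S_mul_right D.hj]; exact hz _ D.quarter_k)
  rw [hs, ← hTd, det_smul] at hd
  simp at hd
  exact hT0 hd

lemma no_mid {d1 d2 d3 l : L} (h1 : d1 = 0 ∨ d1 = 1 / 2 ∨ d1 = 1)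
    (h2 : d2 = 0 ∨ d2 = 1 / 2 ∨ d2 = 1) (h3 : d3 = 0 ∨ d3 = 1 / 2 ∨ d3 = 1)
    (h : d1 + d2 + d3 = 3 * l - 1 / 2) (hl : 6 * l ^ 2 - 6 * l + 1 = 0) : False := by
  have : l = (d1 + d2 + d3 + 1 / 2) / 3 := by linear_combination -h / 3
  rw [this] at hl
  rcases h1 with rfl | rfl | rfl <;> rcases h2 with rfl | rfl | rfl <;>
    rcases h3 with rfl | rfl | rfl <;> norm_num at hl

/-- the case `lam a = 1/2` -/
lemma case_half (D : IsQuat ρ i j P Q) {l : L} (hT : (comprS ρ P Q a).trace = 2 - 3 * l)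
    (hl : 6 * l ^ 2 - 6 * l + 1 = 0) (hd : (comprS ρ P Q a).det = 1 / 2) : False := by
  have hSi := D.S_inv a
  have hmn : comprS ρ P Q a * comprS ρ P Q a⁻¹ = (1 / 2 : L) • 1 := by
    rw [D.S_mul_S_inv, hd]
  have hnm : comprS ρ P Q a⁻¹ * comprS ρ P Q a = (1 / 2 : L) • 1 := by
    rw [D.S_inv_mul_S, hd]
  have hdn : (comprS ρ P Q a⁻¹).det = 1 / 2 := by
    have := congrArg Matrix.det hmn
    rw [det_mul, hd, det_smul] at this
    simp at this
    linear_combination 2 * this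
  have htn : (comprS ρ P Q a⁻¹).trace = (comprS ρ P Q a).trace := D.trS_inv a
  set x := comprS ρ P Q a with hx
  set n := comprS ρ P Q a⁻¹ with hn
  have hval : ∀ κ, IsQuarter ρ i P Q κ →
      (comprS ρ P Q (a⁻¹ * κ⁻¹ * (a * κ * a⁻¹))).det =
        1 / 2 + 1 / 2 * (comprS ρ P Q κ * n * comprS ρ P Q κ * x).trace := by
    intro κ hκ
    have hd1 := D.quarter_det hκ
    have ht1 := hκ.tr
    have e1 : a⁻¹ * (a * κ * a⁻¹) = 1 * κ * a⁻¹ := by group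
    rw [S_three D (D.quarter_quarter_inv hκ), S_three D hκ, e1, S_three D hκ, S_neg D hκ,
      one_mul, mul_inv_cancel, D.S_one, ← hx, ← hn]
    set K := comprS ρ P Q κ with hK
    obtain ⟨K', hK'⟩ : ∃ K', K' = (2 : L) • (n * K * x) := ⟨_, rfl⟩
    have e2 : n * (-K - 1) * x = (-1 / 2 : L) • (K' + 1) := by
      rw [mul_sub, sub_mul, mul_neg, mul_one, neg_mul, hnm, hK', smul_add, smul_smul]
      norm_num
      rw [← neg_smul]; norm_num; abel
    have e3 : n * K = K' * n := by
      rw [hK', Matrix.smul_mul, mul_assoc _ x n, hmn, Matrix.mul_smul, smul_smul, mul_one]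
      norm_num
    have e4 : n + 1 * (K - 1) * n + n * (-K - 1) * (1 + x * (K - 1) * n) =
        ((1 / 2 : L) • (K - K' - 1 - K' * K)) * n := by
      have : n * (-K - 1) * (1 + x * (K - 1) * n) =
          - (n * K) - n + n * (-K - 1) * x * ((K - 1) * n) := by noncomm_ring
      rw [this, e2, e3]
      simp only [mul_sub, sub_mul, add_mul, Matrix.smul_mul, one_mul, mul_assoc]
      module
    have htK' : K'.trace = 0 := by
      rw [hK', trace_smul, Matrix.trace_mul_comm, ← mul_assoc, hmn, Matrix.smul_mul, one_mul,
        trace_smul, ht1]; simp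
    have hdK' : K'.det = 1 := by
      rw [hK', det_smul, det_mul, det_mul, hdn, hd1, hd]; norm_num
    rw [e4, det_mul, det_smul, m2_det_half K K' ht1 hd1 htK' hdK', hdn, hK', Matrix.mul_smul,
      trace_smul]
    simp only [Fintype.card_fin, smul_eq_mul, ← mul_assoc]
    ring
  have hsum := congrArg (fun X => (X * x).trace) (m2_sum D.II D.JJ D.JI n)
  simp only [add_mul, sub_mul, trace_add, trace_sub, hnm, Matrix.smul_mul, trace_smul, one_mul,
    htn, hT] at hsum
  simp at hsum
  have v1 := hval _ D.quarter_i
  have v2 := hval _ D.quarter_j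
  have v3 := hval _ D.quarter_k
  rw [D.S_mul_right D.hj] at v3
  have key : (comprS ρ P Q (a⁻¹ * i⁻¹ * (a * i * a⁻¹))).det +
      (comprS ρ P Q (a⁻¹ * j⁻¹ * (a * j * a⁻¹))).det +
      (comprS ρ P Q (a⁻¹ * (i * j)⁻¹ * (a * (i * j) * a⁻¹))).det = 3 * l - 1 / 2 := by
    rw [v1, v2, v3]
    linear_combination hsum / 2 - (3 / 2) * hl
  exact no_mid (D.lam_mem _) (D.lam_mem _) (D.lam_mem _) key hl

/-- the case `lam a = 1` -/
lemma case_one (D : IsQuat ρ i j P Q) (hd : (comprS ρ P Q a).det = 1) :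
    ρ a * (P * Q) = P * Q * ρ a := by
  have h1 : comprS ρ P Q a * comprS ρ P Q a⁻¹ = 1 := by rw [D.S_mul_S_inv, hd, one_smul]
  have h2 : comprS ρ P Q a⁻¹ * comprS ρ P Q a = 1 := by rw [D.S_inv_mul_S, hd, one_smul]
  obtain ⟨e, he⟩ : ∃ e, e = P * Q := ⟨_, rfl⟩
  obtain ⟨E, hE⟩ : ∃ E, E = ρ a * P * (Q * ρ a⁻¹) := ⟨_, rfl⟩
  have hr : ρ a⁻¹ * ρ a = 1 := by rw [← map_mul, inv_mul_cancel, map_one]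
  have hr' : ρ a * ρ a⁻¹ = 1 := by rw [← map_mul, mul_inv_cancel, map_one]
  have hee : e * e = e := by
    rw [he, Matrix.mul_assoc, ← Matrix.mul_assoc Q, D.QP, Matrix.one_mul]
  have hEe : E = ρ a * e * ρ a⁻¹ := by rw [hE, he]; simp only [Matrix.mul_assoc]
  have hEE : E * E = E := by
    rw [hEe]
    calc _ = ρ a * e * (ρ a⁻¹ * ρ a) * e * ρ a⁻¹ := by simp only [mul_assoc]
      _ = ρ a * (e * e) * ρ a⁻¹ := by rw [hr]; simp only [mul_assoc, one_mul]
      _ = _ := by rw [hee]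
  have heEe : e * E * e = e := by
    rw [he, hE]
    calc _ = P * (comprS ρ P Q a * comprS ρ P Q a⁻¹) * Q := by
            simp only [comprS, Matrix.mul_assoc]
      _ = _ := by rw [h1, Matrix.mul_one]
  have hEeE : E * e * E = E := by
    rw [he, hE]
    calc _ = ρ a * P * (comprS ρ P Q a⁻¹ * comprS ρ P Q a) * (Q * ρ a⁻¹) := by
            simp only [comprS, Matrix.mul_assoc]
      _ = _ := by rw [h2, Matrix.mul_one]
  have hEt : ρ (a * (i * i) * a⁻¹) = 1 - (2 : L) • E := by
    rw [map_mul, map_mul, D.rho_t, mul_sub, mul_one, sub_mul, hr', hEe, he]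
    simp [Matrix.mul_assoc]
  have het : ρ (i * i) = 1 - (2 : L) • e := by rw [he, D.rho_t]
  set x : H := i * i * (a * (i * i) * a⁻¹) with hx
  have hg : ρ x - 1 = (-2 : L) • (e + E - (2 : L) • (e * E)) := by
    rw [hx, map_mul, hEt, het]
    simp only [mul_sub, sub_mul, Matrix.smul_mul, Matrix.mul_smul, one_mul, mul_one]
    module
  have a1 : E * (e * E) = E := by rw [← mul_assoc, hEeE]
  have a2 : e * (E * e) = e := by rw [← mul_assoc, heEe]
  have a3 : e * (e * E) = e * E := by rw [← mul_assoc, hee]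
  have a4 : E * (E * e) = E * e := by rw [← mul_assoc, hEE]
  have hg3 : (ρ x - 1) ^ 3 = 0 := by
    rw [hg, smul_pow]
    have : (e + E - (2 : L) • (e * E)) ^ 2 = e * E + E * e - e - E := by
      rw [sq]
      simp only [mul_sub, sub_mul, mul_add, add_mul, Matrix.smul_mul, Matrix.mul_smul, mul_assoc,
        a1, a2, a3, hee, hEE]
      module
    rw [pow_succ (e + E - (2 : L) • (e * E)), this]
    simp only [mul_sub, sub_mul, mul_add, add_mul, Matrix.smul_mul, Matrix.mul_smul, mul_assoc,
        a1, a2, a3, a4, hee, hEE]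
    module
  have hone : ρ x = 1 := unipotent_finite_order (L := L) (orderOf_pos x)
    (by rw [← map_pow, pow_orderOf_eq_one, map_one]) hg3
  have hrr : ρ (a * (i * i) * a⁻¹) = ρ (i * i) := by
    have h5 : ρ (i * i) * ρ x = ρ (a * (i * i) * a⁻¹) := by
      rw [← map_mul, hx, ← mul_assoc, D.htt, one_mul]
    rw [← h5, hone, mul_one]
  have heq : E = e := by
    rw [hEt, het] at hrr
    have h6 : (2 : L) • E = (2 : L) • e := sub_right_injective hrr
    exact smul_right_injective _ (two_ne_zero (α := L)) h6
  rw [← he]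
  calc ρ a * e = ρ a * e * ρ a⁻¹ * ρ a := by rw [mul_assoc _ (ρ a⁻¹), hr, mul_one]
    _ = e * ρ a := by rw [← hEe, heq]

/-- The characteristic zero statement. -/
theorem charZero_main (D : IsQuat ρ i j P Q) (D2 : IsTri ρ a P2 Q2) :
    (P * Q * (P2 * Q2)).trace = 0 ∨ P * Q = P2 * Q2 := by
  have hinv : a * a = a⁻¹ := eq_inv_of_mul_eq_one_left D2.haaa
  have h3 : (3 : L) ≠ 0 := by norm_num
  obtain ⟨l, hT⟩ : ∃ l, (comprS ρ P Q a).trace = 2 - 3 * l :=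
    ⟨(2 - (comprS ρ P Q a).trace) / 3, by field_simp; ring⟩
  have hBB : Q * P2 * (Q2 * P) = l • 1 := by
    apply smul_right_injective _ h3
    change (3 : L) • (Q * P2 * (Q2 * P)) = (3 : L) • (l • 1)
    have e1 : (3 : L) • (Q * P2 * (Q2 * P)) = Q * ((3 : L) • (P2 * Q2)) * P := by
      simp only [Matrix.smul_mul, Matrix.mul_smul, Matrix.mul_assoc]
    have e2 : Q * ρ a⁻¹ * P = (2 - 3 * l) • 1 - Q * ρ a * P := by
      have := D.S_inv a
      rwa [m2_adj, hT] at this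
    rw [e1, D2.PQ, hinv]
    simp only [Matrix.mul_sub, Matrix.sub_mul, Matrix.mul_add, Matrix.add_mul, Matrix.mul_one,
      Matrix.mul_smul, Matrix.smul_mul, D.QP, e2]
    module
  have htr : (P * Q * (P2 * Q2)).trace = 2 * l := by
    have : P * Q * (P2 * Q2) = P * (Q * P2 * Q2) := by simp only [Matrix.mul_assoc]
    rw [this, Matrix.trace_mul_comm, Matrix.mul_assoc, hBB, trace_smul]
    simp [mul_comm]
  by_cases hl : l = 0
  · left; rw [htr, hl, mul_zero]
  right
  have hBB' : Q2 * P * (Q * P2) = l • 1 := by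
    have e1 : (l⁻¹ • (Q * P2)) * (Q2 * P) = 1 := by
      rw [Matrix.smul_mul, hBB, smul_smul, inv_mul_cancel₀ hl, one_smul]
    have e2 := mul_eq_one_comm.mp e1
    rw [Matrix.mul_smul] at e2
    rw [← e2, smul_smul, mul_inv_cancel₀ hl, one_smul]
  have hdet : (comprS ρ P Q a).det = 1 - 3 * l + 3 * l ^ 2 := by
    have e1 : comprS ρ P Q a = 1 + Q * P2 * ((Q2 * ρ a * P2 - 1) * (Q2 * P)) := by
      rw [comprS, D2.eq, Matrix.mul_add, Matrix.add_mul, Matrix.mul_one, D.QP, ← D2.eq]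
      simp only [Matrix.mul_assoc]
    rw [e1, det_one_add_mul_comm, Matrix.mul_assoc, hBB', Matrix.mul_smul, Matrix.mul_one]
    exact m2_det_three _ _ D2.alpha_tr D2.alpha_det
  rcases D.lam_mem a with h | h | h
  · exfalso
    rw [h] at hdet
    refine case_zero D D2.haaa ?_ h
    rw [hT]; linear_combination (9 * l - 9) * hdet
  · exfalso
    rw [h] at hdet
    exact case_half D hT (by linear_combination (-2) * hdet) h
  · have hc := case_one D h
    have hl1 : l = 1 := by
      rw [h] at hdet
      have : l * (l - 1) = 0 := by linear_combination -hdet / 3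
      have := (mul_eq_zero.mp this).resolve_left hl
      linear_combination this
    rw [hl1, one_smul] at hBB hBB'
    have hcc : ρ a⁻¹ * (P * Q) = P * Q * ρ a⁻¹ := by
      rw [← hinv, map_mul, mul_assoc, hc, ← mul_assoc, hc, mul_assoc]
    have hcomm : P2 * Q2 * (P * Q) = P * Q * (P2 * Q2) := by
      apply smul_right_injective _ h3
      change (3 : L) • (P2 * Q2 * (P * Q)) = (3 : L) • (P * Q * (P2 * Q2))
      rw [← Matrix.smul_mul (3 : L) (P2 * Q2), ← Matrix.mul_smul (P * Q) (3 : L), D2.PQ, hinv]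
      simp only [mul_sub, sub_mul, mul_add, add_mul, hc, hcc, Matrix.smul_mul, Matrix.mul_smul,
        one_mul, mul_one]
    have hPQ : P * Q * (P2 * Q2) * P = P := by
      have : P * Q * (P2 * Q2) * P = P * (Q * P2 * (Q2 * P)) := by simp only [Matrix.mul_assoc]
      rw [this, hBB, Matrix.mul_one]
    have hQP : Q * (P * Q * (P2 * Q2)) = Q * P2 * Q2 := by
      simp only [← Matrix.mul_assoc, D.QP, Matrix.one_mul]
    have f1 : P2 * Q2 * P = P := by
      rw [← hcomm] at hPQ
      simpa only [Matrix.mul_assoc, D.QP, Matrix.mul_one] using hPQ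
    have f2 : Q * (P2 * Q2) = Q := by
      rw [← hcomm] at hQP
      have : Q * (P2 * Q2 * (P * Q)) = Q * P2 * (Q2 * P) * Q := by simp only [Matrix.mul_assoc]
      rw [this, hBB, Matrix.one_mul, Matrix.mul_assoc] at hQP
      exact hQP.symm
    calc P * Q = P2 * Q2 * P * (Q * (P2 * Q2)) := by rw [f1, f2]
      _ = P2 * (Q2 * P * (Q * P2)) * Q2 := by simp only [Matrix.mul_assoc]
      _ = P2 * Q2 := by rw [hBB', Matrix.mul_one]

end CZero

section lift
variable {W F m H : Type*} [CommRing W] [Field F] [Fintype m] [DecidableEq m] [Group H] [Fintype H]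

theorem lift_step (w : W) (red : W →+* F) (hred : ∀ x, red x ≠ 0 → IsUnit x) (hw : red w = 0)
    (hH : (Fintype.card H : F) ≠ 0)
    (ρ : H →* Matrix m m F) (k : ℕ) (f : H → Matrix m m W)
    (hf : ∀ h, (f h).map red = ρ h)
    (hm : ∀ g h, ∃ e, f (g * h) = f g * f h + w ^ (k + 1) • e) :
    ∃ f' : H → Matrix m m W, (∀ h, (f' h).map red = ρ h) ∧
      (∀ g h, ∃ e, f' (g * h) = f' g * f' h + w ^ (k + 2) • e) ∧
      (∀ g, ∃ d, f' g = f g + w ^ (k + 1) • d) := by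
  have hu : ∀ h, ∃ v, f h * v = 1 := by
    intro h
    have h1 : IsUnit (f h).det := by
      apply hred
      have : red (f h).det = (ρ h).det := by
        rw [← hf h, RingHom.map_det]; rfl
      rw [this]
      have h2 : ρ h * ρ h⁻¹ = 1 := by rw [← map_mul]; simp
      have h3 := congrArg Matrix.det h2
      rw [Matrix.det_mul, Matrix.det_one] at h3
      intro h4; rw [h4, zero_mul] at h3; exact zero_ne_one h3
    exact ⟨(f h)⁻¹, Matrix.mul_nonsing_inv _ h1⟩
  choose v hv using hu
  have hv' : ∀ h, v h * f h = 1 := fun h => mul_eq_one_comm.mp (hv h)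
  choose e he using hm
  obtain ⟨c, hc⟩ : ∃ c : W, c * (Fintype.card H : W) = 1 := by
    have : IsUnit (Fintype.card H : W) := hred _ (by simpa using hH)
    obtain ⟨u, hu⟩ := this
    exact ⟨(↑u⁻¹ : W), by rw [← hu]; simp⟩
  have hav : ∀ X : Matrix m m W, c • ∑ _h : H, X = X := by
    intro X
    rw [Finset.sum_const, Finset.card_univ, ← Nat.cast_smul_eq_nsmul W, smul_smul, hc, one_smul]
  obtain ⟨d, hd⟩ : ∃ d : H → Matrix m m W, ∀ g, d g = c • ∑ h, e g h * v h := ⟨_, fun g => rfl⟩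
  refine ⟨fun g => f g + w ^ (k + 1) • d g, ?_, ?_, fun g => ⟨d g, rfl⟩⟩
  · intro h
    ext a b
    have := congrFun (congrFun (hf h) a) b
    simp only [Matrix.map_apply] at this
    simp [hw, this]
  · intro g1 g2
    have coc : ∀ h, w ^ (k + 1) • (e g1 g2 * f h + e (g1 * g2) h - f g1 * e g2 h - e g1 (g2 * h)) = 0 := by
      intro h
      have h1 := he (g1 * g2) h
      have h2 := he g1 (g2 * h)
      rw [← mul_assoc, h1, he g1 g2, he g2 h] at h2
      simp only [add_mul, mul_add, Matrix.smul_mul, Matrix.mul_smul, mul_assoc] at h2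
      have h3 := sub_eq_zero.mpr h2
      rw [← h3]
      module
    have coc2 : ∀ h, w ^ (k + 1) • e g1 g2 = w ^ (k + 1) • (f g1 * (e g2 h * v h) + e g1 (g2 * h) * v (g2 * h) * f g2 - e (g1 * g2) h * v h)
        + w ^ (2 * k + 2) • (e g1 (g2 * h) * v (g2 * h) * e g2 h * v h) := by
      intro h
      have h1 := congrArg (· * v h) (coc h)
      simp only [Matrix.smul_mul, sub_mul, add_mul, mul_assoc, hv, zero_mul, mul_one] at h1
      have h2 : v h = v (g2 * h) * f g2 + w ^ (k + 1) • (v (g2 * h) * (e g2 h * v h)) := by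
        have h3 := hv' (g2 * h)
        calc v h = (v (g2 * h) * f (g2 * h)) * v h := by rw [h3, one_mul]
          _ = _ := by
            rw [he g2 h]
            simp only [add_mul, mul_add, Matrix.smul_mul, Matrix.mul_smul, mul_assoc, hv, mul_one]
      have h4 : e g1 (g2 * h) * v h = e g1 (g2 * h) * (v (g2 * h) * f g2) + w ^ (k + 1) • (e g1 (g2 * h) * (v (g2 * h) * (e g2 h * v h))) := by
        conv_lhs => rw [h2]
        rw [mul_add, Matrix.mul_smul]
      rw [h4] at h1
      rw [← sub_eq_zero, ← h1]
      simp only [mul_assoc]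
      module
    obtain ⟨E, hE⟩ : ∃ E, w ^ (k + 1) • e g1 g2 = w ^ (k + 1) • (f g1 * d g2 + d g1 * f g2 - d (g1 * g2)) + w ^ (2 * k + 2) • E := by
      refine ⟨c • ∑ h, e g1 (g2 * h) * v (g2 * h) * e g2 h * v h, ?_⟩
      rw [← hav (w ^ (k + 1) • e g1 g2), Finset.sum_congr rfl (fun h _ => coc2 h)]
      have : d g1 = c • ∑ h, e g1 (g2 * h) * v (g2 * h) := by
        rw [hd, ← Equiv.sum_comp (Equiv.mulLeft g2)]; rfl
      rw [this, hd g2, hd (g1 * g2)]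
      simp only [Finset.sum_add_distrib, ← Finset.smul_sum, Finset.sum_sub_distrib, Matrix.smul_mul, Matrix.mul_smul, Finset.mul_sum, Finset.sum_mul]
      module
    refine ⟨w ^ k • (E - d g1 * d g2), ?_⟩
    simp only [he g1 g2, mul_add, add_mul, Matrix.smul_mul, Matrix.mul_smul]
    rw [hE]
    module

theorem lift_rep (w : W) (red : W →+* F) (hsurj : Function.Surjective red)
    (hker : ∀ x, red x = 0 → ∃ y, x = w * y)
    (hred : ∀ x, red x ≠ 0 → IsUnit x) (hw : red w = 0)
    [IsAdicComplete (Ideal.span {w}) W]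
    (hH : (Fintype.card H : F) ≠ 0) (ρ : H →* Matrix m m F) :
    ∃ ρ' : H →* Matrix m m W, ∀ h, (ρ' h).map red = ρ h := by
  let S : ℕ → Type _ := fun k => {f : H → Matrix m m W // (∀ h, (f h).map red = ρ h) ∧
    ∀ g h, ∃ e, f (g * h) = f g * f h + w ^ (k + 1) • e}
  have hstep : ∀ k (f : S k), ∃ f' : S (k + 1), ∀ g, ∃ d, f'.1 g = f.1 g + w ^ (k + 1) • d := by
    intro k f
    obtain ⟨f', h1, h2, h3⟩ := lift_step w red hred hw hH ρ k f.1 f.2.1 f.2.2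
    exact ⟨⟨f', h1, h2⟩, h3⟩
  choose nx hnx using hstep
  have h0 : Nonempty (S 0) := by
    choose s hs using hsurj
    refine ⟨⟨fun h => (ρ h).map s, ?_, ?_⟩⟩
    · intro h; ext a b; simp [hs]
    · intro g h
      have : ∀ a b, ∃ y, ((ρ (g * h)).map s - (ρ g).map s * (ρ h).map s) a b = w * y := by
        intro a b
        apply hker
        have h1 : (((ρ (g * h)).map s - (ρ g).map s * (ρ h).map s).map red) = 0 := by
          rw [Matrix.map_sub _ (map_sub red), Matrix.map_mul]
          have : ∀ X : Matrix m m F, (X.map s).map red = X := by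
            intro X; ext a b; simp [hs]
          simp [this]
        exact congrFun (congrFun h1 a) b
      choose y hy using this
      refine ⟨Matrix.of y, ?_⟩
      ext a b
      have := hy a b
      simp only [Matrix.sub_apply] at this
      simp only [Matrix.add_apply, Matrix.smul_apply, Matrix.of_apply, smul_eq_mul, zero_add, pow_one]
      linear_combination this
  obtain ⟨f0⟩ := h0
  let fs : ∀ k, S k := fun k => Nat.rec f0 (fun k f => nx k f) k
  have hfs : ∀ k g, ∃ d, (fs (k + 1)).1 g = (fs k).1 g + w ^ (k + 1) • d := fun k g => hnx k (fs k) g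
  have hfs2 : ∀ k j g, ∃ d, (fs (k + j)).1 g = (fs k).1 g + w ^ (k + 1) • d := by
    intro k j g
    induction j with
    | zero => exact ⟨0, by simp⟩
    | succ j ih =>
      obtain ⟨d, hd⟩ := ih
      obtain ⟨d', hd'⟩ := hfs (k + j) g
      refine ⟨d + w ^ j • d', ?_⟩
      rw [← add_assoc, hd', hd]
      module
  have hmem : ∀ n x y, x ≡ y [SMOD ((Ideal.span {w}) ^ n • ⊤ : Submodule W W)] ↔ ∃ z, x = y + w ^ n * z := by
    intro n x y
    rw [SModEq.sub_mem, smul_eq_mul, Ideal.mul_top, Ideal.span_singleton_pow, Ideal.mem_span_singleton]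
    constructor
    · rintro ⟨z, hz⟩; exact ⟨z, by linear_combination hz⟩
    · rintro ⟨z, hz⟩; exact ⟨z, by linear_combination hz⟩
  have hlim : ∀ g a b, ∃ L : W, ∀ n, (fs n).1 g a b ≡ L [SMOD ((Ideal.span {w}) ^ n • ⊤ : Submodule W W)] := by
    intro g a b
    apply IsPrecomplete.prec (inferInstance : IsPrecomplete (Ideal.span {w}) W)
    intro k n hkn
    obtain ⟨j, rfl⟩ := Nat.exists_eq_add_of_le hkn
    obtain ⟨d, hd⟩ := hfs2 k j g
    rw [hmem]
    refine ⟨- w * d a b, ?_⟩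
    rw [hd]
    simp only [Matrix.add_apply, Matrix.smul_apply, smul_eq_mul]
    ring
  choose L hL using hlim
  have hL' : ∀ n g, ∃ z, (fs n).1 g = Matrix.of (L g) + w ^ n • z := by
    intro n g
    have := fun a b => (hmem _ _ _).1 (hL g a b n)
    choose z hz using this
    exact ⟨Matrix.of z, by ext a b; simpa using hz a b⟩
  have hlred : ∀ g, (Matrix.of (L g)).map red = ρ g := by
    intro g
    obtain ⟨z, hz⟩ := hL' 1 g
    rw [← (fs 1).2.1 g, hz]
    ext a b; simp [hw]
  have hmul : ∀ g h, Matrix.of (L (g * h)) = Matrix.of (L g) * Matrix.of (L h) := by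
    intro g h
    have key : ∀ n, ∃ z, Matrix.of (L (g * h)) = Matrix.of (L g) * Matrix.of (L h) + w ^ n • z := by
      intro n
      obtain ⟨z1, h1⟩ := hL' n (g * h)
      obtain ⟨z2, h2⟩ := hL' n g
      obtain ⟨z3, h3⟩ := hL' n h
      obtain ⟨e, he⟩ := (fs n).2.2 g h
      rw [h1, h2, h3] at he
      refine ⟨- z1 + of (L g) * z3 + z2 * of (L h) + w ^ n • (z2 * z3) + w • e, ?_⟩
      simp only [add_mul, mul_add, Matrix.smul_mul, Matrix.mul_smul] at he
      rw [eq_sub_of_add_eq he]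
      module
    ext a b
    rw [IsHausdorff.eq_iff_smodEq (I := Ideal.span {w})]
    intro n
    obtain ⟨z, hz⟩ := key n
    rw [hmem]
    exact ⟨z a b, by rw [hz]; simp⟩
  have hone : Matrix.of (L 1) = 1 := by
    have h1 := hmul 1 1
    rw [mul_one] at h1
    have hu : IsUnit (Matrix.of (L 1)).det := by
      apply hred
      have : red (Matrix.of (L 1)).det = (ρ 1).det := by rw [← hlred 1, RingHom.map_det]; rfl
      rw [this]; simp
    have h2 : IsUnit (Matrix.of (L 1)) := (Matrix.isUnit_iff_isUnit_det _).2 hu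
    exact (h2.mul_left_cancel (by rw [mul_one]; exact h1)).symm
  exact ⟨⟨⟨fun g => Matrix.of (L g), hone⟩, hmul⟩, hlred⟩

end lift

section lift2
variable {W F L m H : Type*} [CommRing W] [Field F] [Field L] [Fintype m] [DecidableEq m] [Group H]

theorem idem_red_zero (red : W →+* F) (hred : ∀ x, red x ≠ 0 → IsUnit x)
    (x : Matrix m m W) (hx : x * x = x) (h0 : x.map red = 0) : x = 0 := by
  have hu : IsUnit (1 - x).det := by
    apply hred
    have : red (1 - x).det = ((1 - x).map red).det := by rw [RingHom.map_det]; rfl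
    rw [this, Matrix.map_sub _ (map_sub red), h0]
    simp
  have h2 : IsUnit (1 - x) := (Matrix.isUnit_iff_isUnit_det _).2 hu
  apply h2.mul_left_cancel
  rw [sub_mul, hx]; simp

theorem idem_split (red : W →+* F) (hsurj : Function.Surjective red) (hred : ∀ x, red x ≠ 0 → IsUnit x)
    (e : Matrix m m W) (he : e * e = e) (P0 : Matrix m (Fin 2) F) (Q0 : Matrix (Fin 2) m F)
    (hQP : Q0 * P0 = 1) (hr : e.map red = P0 * Q0) :
    ∃ (P : Matrix m (Fin 2) W) (Q : Matrix (Fin 2) m W), Q * P = 1 ∧ P * Q = e := by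
  obtain ⟨s, hs⟩ := hsurj.hasRightInverse
  have hs : ∀ x, red (s x) = x := hs
  obtain ⟨P1, hP1⟩ : ∃ P1 : Matrix m (Fin 2) W, P1.map red = P0 := ⟨P0.map s, by ext a b; simp [hs]⟩
  obtain ⟨Q1, hQ1⟩ : ∃ Q1 : Matrix (Fin 2) m W, Q1.map red = Q0 := ⟨Q0.map s, by ext a b; simp [hs]⟩
  have hX : (Q1 * e * P1).map red = 1 := by
    rw [Matrix.map_mul, Matrix.map_mul, hP1, hQ1, hr]
    rw [← Matrix.mul_assoc, hQP, Matrix.one_mul, hQP]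
  have hu : IsUnit (Q1 * e * P1).det := by
    apply hred
    have : red (Q1 * e * P1).det = ((Q1 * e * P1).map red).det := by rw [RingHom.map_det]; rfl
    rw [this, hX]; simp
  obtain ⟨Y, hY⟩ : ∃ Y, Y = (Q1 * e * P1)⁻¹ := ⟨_, rfl⟩
  have hY1 : Y * (Q1 * e * P1) = 1 := by rw [hY]; exact Matrix.nonsing_inv_mul _ hu
  have hYr : Y.map red = 1 := by
    have h1 := congrArg (fun M => M.map red) hY1
    rw [Matrix.map_mul, hX, Matrix.mul_one] at h1
    rw [h1]; simp
  have hQP' : (Y * Q1 * e) * (e * P1) = 1 := by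
    rw [← hY1]
    conv_rhs => rw [← he]
    simp only [Matrix.mul_assoc]
  refine ⟨e * P1, Y * Q1 * e, hQP', ?_⟩
  have h0 : e - (e * P1) * (Y * Q1 * e) = 0 := by
    apply idem_red_zero red hred
    · have a1 : e * (e * P1 * (Y * Q1 * e)) = e * P1 * (Y * Q1 * e) := by
        rw [Matrix.mul_assoc e P1, ← Matrix.mul_assoc e e, he]
      have a2 : (e * P1 * (Y * Q1 * e)) * e = e * P1 * (Y * Q1 * e) := by
        simp only [Matrix.mul_assoc, he]
      have a3 : (e * P1 * (Y * Q1 * e)) * (e * P1 * (Y * Q1 * e)) = e * P1 * (Y * Q1 * e) := by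
        calc _ = e * P1 * ((Y * Q1 * e) * (e * P1)) * (Y * Q1 * e) := by simp only [Matrix.mul_assoc]
          _ = _ := by rw [hQP', Matrix.mul_one]
      rw [sub_mul, mul_sub, mul_sub, he, a1, a2, a3]; abel
    · rw [Matrix.map_sub _ (map_sub red)]
      simp only [Matrix.map_mul, hr, hP1, hQ1, hYr, Matrix.one_mul]
      have : P0 * Q0 * P0 = P0 := by rw [Matrix.mul_assoc, hQP, Matrix.mul_one]
      rw [this]
      have : Q0 * (P0 * Q0) = Q0 := by rw [← Matrix.mul_assoc, hQP, Matrix.one_mul]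
      rw [this]; simp
  exact (sub_eq_zero.mp h0).symm

theorem trace_inv_of_form {R : Type*} [CommRing R] (ρ : H →* Matrix m m R) (J : Matrix m m R) (hJ : IsUnit J.det)
    (h : ∀ g, (ρ g)ᵀ * J * ρ g = J) (g : H) : (ρ g⁻¹).trace = (ρ g).trace := by
  have h1 : ρ g * ρ g⁻¹ = 1 := by rw [← map_mul]; simp
  have h2 : (ρ g)ᵀ * J = J * ρ g⁻¹ := by
    calc (ρ g)ᵀ * J = (ρ g)ᵀ * J * (ρ g * ρ g⁻¹) := by rw [h1, mul_one]
      _ = _ := by rw [← mul_assoc, h g]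
  have h3 : ρ g⁻¹ = J⁻¹ * ((ρ g)ᵀ * J) := by
    rw [h2, ← mul_assoc, Matrix.nonsing_inv_mul _ hJ, one_mul]
  rw [h3, Matrix.trace_mul_comm, mul_assoc, Matrix.mul_nonsing_inv _ hJ, mul_one, Matrix.trace_transpose]

theorem trace_inv_lift [Fintype H] (red : W →+* F) (hsurj : Function.Surjective red) (hred : ∀ x, red x ≠ 0 → IsUnit x)
    (hH : (Fintype.card H : F) ≠ 0) (ρ : H →* Matrix m m F) (ρ' : H →* Matrix m m W)
    (hρ : ∀ h, (ρ' h).map red = ρ h) (J : Matrix m m F) (hJ : IsUnit J.det)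
    (h : ∀ g, (ρ g)ᵀ * J * ρ g = J) (g : H) : (ρ' g⁻¹).trace = (ρ' g).trace := by
  obtain ⟨s, hs⟩ := hsurj.hasRightInverse
  have hs : ∀ x, red (s x) = x := hs
  obtain ⟨J1, hJ1⟩ : ∃ J1 : Matrix m m W, J1.map red = J := ⟨J.map s, by ext a b; simp [hs]⟩
  refine trace_inv_of_form ρ' (∑ h, (ρ' h)ᵀ * J1 * ρ' h) ?_ ?_ g
  · apply hred
    have h1 : (∑ h, (ρ' h)ᵀ * J1 * ρ' h).map red = (Fintype.card H : F) • J := by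
      have : ∀ X : Matrix m m W, X.map red = red.mapMatrix X := fun X => rfl
      rw [this, map_sum]
      have h2 : ∀ g, red.mapMatrix ((ρ' g)ᵀ * J1 * ρ' g) = J := by
        intro g
        rw [map_mul, map_mul, ← this, ← this, ← this, hJ1, hρ, Matrix.transpose_map, hρ, h]
      simp only [h2]
      rw [Finset.sum_const, Finset.card_univ, ← Nat.cast_smul_eq_nsmul F]
    have : red (∑ h, (ρ' h)ᵀ * J1 * ρ' h).det = ((∑ h, (ρ' h)ᵀ * J1 * ρ' h).map red).det := by rw [RingHom.map_det]; rfl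
    rw [this, h1, Matrix.det_smul]
    exact mul_ne_zero (pow_ne_zero _ hH) hJ.ne_zero
  · intro g
    rw [Finset.mul_sum, Finset.sum_mul]
    conv_rhs => rw [← Equiv.sum_comp (Equiv.mulRight g)]
    refine Finset.sum_congr rfl fun h _ => ?_
    simp [Matrix.transpose_mul, mul_assoc]

def mapRep (φ : W →+* L) (ρ : H →* Matrix m m W) : H →* Matrix m m L :=
  (φ.mapMatrix : Matrix m m W →+* Matrix m m L).toMonoidHom.comp ρ

theorem mapRep_apply (φ : W →+* L) (ρ : H →* Matrix m m W) (h : H) : mapRep φ ρ h = (ρ h).map φ := rfl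

theorem quat_lift (red : W →+* F) (hsurj : Function.Surjective red) (hred : ∀ x, red x ≠ 0 → IsUnit x)
    (h2 : (2 : F) ≠ 0) (ρ : H →* Matrix m m F) (ρ' : H →* Matrix m m W)
    (hρ : ∀ h, (ρ' h).map red = ρ h) (hinv : ∀ g, (ρ' g⁻¹).trace = (ρ' g).trace)
    (φ : W →+* L) {i j : H} {P0 : Matrix m (Fin 2) F} {Q0 : Matrix (Fin 2) m F}
    (D : IsQuat ρ i j P0 Q0) :
    ∃ (P : Matrix m (Fin 2) W) (Q : Matrix (Fin 2) m W), (P * Q).map red = P0 * Q0 ∧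
      IsQuat (mapRep φ ρ') i j (P.map φ) (Q.map φ) := by
  obtain ⟨c, hc⟩ : ∃ c : W, c * 2 = 1 := by
    have : IsUnit (2 : W) := hred _ (by rw [map_ofNat]; exact h2)
    obtain ⟨u, hu⟩ := this
    exact ⟨(↑u⁻¹ : W), by rw [← hu]; simp⟩
  have hcr : red c * 2 = 1 := by have := congrArg red hc; rwa [map_mul, map_ofNat, map_one] at this
  obtain ⟨t, ht⟩ : ∃ t, t = ρ' (i * i) := ⟨_, rfl⟩
  have htt : t * t = 1 := by rw [ht, ← map_mul, D.htt, map_one]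
  obtain ⟨e, hedef⟩ : ∃ e, e = c • (1 - t) := ⟨_, rfl⟩
  have he : e * e = e := by
    rw [hedef, Matrix.smul_mul, Matrix.mul_smul, smul_smul, mul_sub, sub_mul, sub_mul, htt]
    simp only [mul_one, one_mul]
    have : c = c * c * 2 := by linear_combination -c * hc
    conv_rhs => rw [this]
    module
  have her : e.map red = P0 * Q0 := by
    have h3 : red.mapMatrix e = red c • (1 - ρ (i * i)) := by
      have h4 : red.mapMatrix t = ρ (i * i) := by rw [ht]; exact hρ _
      rw [← h4, hedef, ← map_one red.mapMatrix, ← map_sub]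
      ext a b; simp
    rw [← D.PQ, smul_smul, hcr, one_smul] at h3
    exact h3
  obtain ⟨P, Q, hQP, hPQ⟩ := idem_split red hsurj hred e he P0 Q0 D.QP her
  have fixg : ∀ g : H, g * g = i * i → ρ g = 1 + P0 * (Q0 * ρ g * P0 - 1) * Q0 → ρ' g = 1 + P * (Q * ρ' g * P - 1) * Q := by
    intro g hg hgF
    obtain ⟨u, hu⟩ : ∃ u, u = ρ' g := ⟨_, rfl⟩
    have hut : u * u = t := by rw [hu, ht, ← map_mul, hg]
    have hur : u.map red = ρ g := by rw [hu]; exact hρ g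
    have hcomm : u * t = t * u := by rw [← hut, mul_assoc]
    have hx : c • ((1 - u) * (1 - e)) = 0 := by
      apply idem_red_zero red hred
      · have hc4 : (1 - u) * (1 - e) = c • (1 + t - u - u * t) := by
          rw [hedef]
          have : (1 : Matrix m m W) = (c * 2) • 1 := by rw [hc, one_smul]
          simp only [mul_sub, sub_mul, Matrix.mul_smul, one_mul, mul_one]
          have h5 : (1 - u) = (c * 2) • (1 - u) := by rw [hc, one_smul]
          rw [h5]
          module
        rw [hc4, smul_smul, Matrix.smul_mul, Matrix.mul_smul, smul_smul]
        have : (1 + t - u - u * t) * (1 + t - u - u * t) = (4 : W) • (1 + t - u - u * t) := by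
          have e1 : t * u = u * t := hcomm.symm
          have e2 : u * (u * t) = 1 := by rw [← mul_assoc, hut, htt]
          have e3 : t * (u * t) = u := by rw [← mul_assoc, ← hcomm, mul_assoc, htt, mul_one]
          simp only [mul_add, add_mul, mul_sub, sub_mul, mul_one, one_mul, mul_assoc, e1, e2, e3, htt, hut]
          module
        rw [this, smul_smul]
        congr 1
        linear_combination (c*c*(c*2+1)) * hc
      · have h6 : red.mapMatrix (c • ((1 - u) * (1 - e))) = red c • ((1 - ρ g) * (1 - P0 * Q0)) := by
          have h7 : red.mapMatrix u = ρ g := hur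
          have h8 : red.mapMatrix e = P0 * Q0 := her
          rw [← h7, ← h8, ← map_one red.mapMatrix, ← map_sub, ← map_sub, ← map_mul]
          generalize (1 - u) * (1 - e) = X
          ext a b; simp
        have h9 : (1 - ρ g) * (1 - P0 * Q0) = 0 := by
          have h10 : Q0 * (1 - P0 * Q0) = 0 := by
            rw [Matrix.mul_sub, ← Matrix.mul_assoc, D.QP]; simp
          rw [hgF, sub_add_cancel_left, Matrix.neg_mul, Matrix.mul_assoc, h10]; simp
        rw [h9, smul_zero] at h6
        exact h6
    have hx2 : (1 - u) * (1 - e) = 0 := by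
      have := congrArg ((2 : W) • ·) hx
      simp only [smul_smul, smul_zero] at this
      rwa [mul_comm, hc, one_smul] at this
    have hue : u * e = e * u := by
      rw [hedef, Matrix.mul_smul, Matrix.smul_mul, mul_sub, sub_mul, hcomm]; simp
    rw [← hu]
    calc u = 1 + e * u * e - e := by
          rw [← hue, mul_assoc, he]
          rw [sub_mul, one_mul, mul_sub, mul_one] at hx2
          have := sub_eq_zero.mp hx2
          rw [eq_sub_iff_add_eq, ← sub_eq_sub_iff_add_eq_add]
          exact this.symm
      _ = _ := by
          rw [← hPQ]
          simp only [Matrix.mul_sub, Matrix.sub_mul, Matrix.mul_assoc, Matrix.mul_one]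
          abel
  have mm : ∀ X : Matrix m m W, X.map φ = φ.mapMatrix X := fun X => rfl
  have tomap : ∀ g : H, ρ' g = 1 + P * (Q * ρ' g * P - 1) * Q →
      mapRep φ ρ' g = 1 + P.map φ * (Q.map φ * mapRep φ ρ' g * P.map φ - 1) * Q.map φ := by
    intro g hg
    rw [mapRep_apply]
    conv_lhs => rw [hg]
    rw [Matrix.map_add _ (map_add φ), Matrix.map_mul, Matrix.map_mul, Matrix.map_sub _ (map_sub φ), Matrix.map_mul, Matrix.map_mul]
    simp
  refine ⟨P, Q, by rw [hPQ, her], ⟨D.hjj, D.htt, D.hji, ?_, ?_, tomap i (fixg i rfl D.hi), tomap j (fixg j D.hjj D.hj), ?_⟩⟩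
  · rw [← Matrix.map_mul, hQP]; simp
  · rw [← Matrix.map_mul, hPQ, mapRep_apply, ← ht]
    have h11 : (2 : W) • e = 1 - t := by rw [hedef, smul_smul, mul_comm, hc, one_smul]
    have h12 := congrArg φ.mapMatrix h11
    rw [map_sub, map_one] at h12
    rw [mm t, ← h12]
    ext a b
    simp only [Matrix.smul_apply, Matrix.map_apply, RingHom.mapMatrix_apply, smul_eq_mul, map_mul, map_ofNat]
  · intro h
    rw [mapRep_apply, mapRep_apply]
    have h13 : ∀ X : Matrix m m W, (X.map φ).trace = φ X.trace := fun X => by simp [Matrix.trace]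
    rw [h13, h13, hinv]

theorem tri_lift (red : W →+* F) (hsurj : Function.Surjective red) (hred : ∀ x, red x ≠ 0 → IsUnit x)
    (h3 : (3 : F) ≠ 0) (ρ : H →* Matrix m m F) (ρ' : H →* Matrix m m W)
    (hρ : ∀ h, (ρ' h).map red = ρ h) (hinv : ∀ g, (ρ' g⁻¹).trace = (ρ' g).trace)
    (φ : W →+* L) {a : H} {P0 : Matrix m (Fin 2) F} {Q0 : Matrix (Fin 2) m F}
    (D : IsTri ρ a P0 Q0) :
    ∃ (P : Matrix m (Fin 2) W) (Q : Matrix (Fin 2) m W), (P * Q).map red = P0 * Q0 ∧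
      IsTri (mapRep φ ρ') a (P.map φ) (Q.map φ) := by
  obtain ⟨c, hc⟩ : ∃ c : W, c * 3 = 1 := by
    have : IsUnit (3 : W) := hred _ (by rw [map_ofNat]; exact h3)
    obtain ⟨u, hu⟩ := this
    exact ⟨(↑u⁻¹ : W), by rw [← hu]; simp⟩
  have hcr : red c * 3 = 1 := by have := congrArg red hc; rwa [map_mul, map_ofNat, map_one] at this
  obtain ⟨t, ht⟩ : ∃ t, t = ρ' a := ⟨_, rfl⟩
  have htt : ρ' (a * a) = t * t := by rw [ht, map_mul]
  have httt : t * (t * t) = 1 := by rw [ht, ← map_mul, ← map_mul, ← mul_assoc, D.haaa, map_one]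
  obtain ⟨e, hedef⟩ : ∃ e, e = c • ((3 : W) • 1 - (1 + t + t * t)) := ⟨_, rfl⟩
  have he : e * e = e := by
    rw [hedef, Matrix.smul_mul, Matrix.mul_smul, smul_smul]
    have h4 : t * (t * (t * t)) = t := by rw [httt, mul_one]
    have : ((3 : W) • 1 - (1 + t + t * t)) * ((3 : W) • 1 - (1 + t + t * t)) = (3 : W) • ((3 : W) • 1 - (1 + t + t * t)) := by
      simp only [mul_add, add_mul, mul_sub, sub_mul, mul_one, one_mul, mul_assoc, Matrix.smul_mul, Matrix.mul_smul, httt, h4]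
      module
    rw [this, smul_smul]
    congr 1
    linear_combination c * hc
  have her : e.map red = P0 * Q0 := by
    have h3 : red.mapMatrix e = red c • ((3 : F) • 1 - (1 + ρ a + ρ (a * a))) := by
      have h4 : red.mapMatrix t = ρ a := by rw [ht]; exact hρ _
      have h5 : red.mapMatrix (t * t) = ρ (a * a) := by rw [map_mul, h4, map_mul]
      have h6 : red.mapMatrix ((3 : W) • (1 : Matrix m m W)) = (3 : F) • 1 := by
        rw [← map_one red.mapMatrix]
        generalize (1 : Matrix m m W) = X
        ext a b
        simp only [Matrix.smul_apply, Matrix.map_apply, RingHom.mapMatrix_apply, smul_eq_mul, map_mul, map_ofNat]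
      rw [← h4, ← h5, ← h6, hedef, ← map_one red.mapMatrix, ← map_add, ← map_add, ← map_sub]
      generalize ((3 : W) • 1 - (1 + t + t * t)) = X
      ext a b; simp
    rw [← D.PQ, smul_smul, hcr, one_smul] at h3
    exact h3
  obtain ⟨P, Q, hQP, hPQ⟩ := idem_split red hsurj hred e he P0 Q0 D.QP her
  have mm : ∀ X : Matrix m m W, X.map φ = φ.mapMatrix X := fun X => rfl
  refine ⟨P, Q, by rw [hPQ, her], ⟨D.haaa, ?_, ?_, ?_⟩⟩
  · rw [← Matrix.map_mul, hQP]; simp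
  · rw [← Matrix.map_mul, hPQ, mapRep_apply, mapRep_apply, htt, ← ht]
    have h11 : (3 : W) • e + (1 + t + t * t) = (3 : W) • 1 := by
      rw [hedef, smul_smul, mul_comm, hc, one_smul]; abel
    have h12 := congrArg φ.mapMatrix h11
    rw [map_add, map_add, map_add, map_one] at h12
    have h13 : ∀ X, φ.mapMatrix ((3 : W) • (X : Matrix m m W)) = (3 : L) • φ.mapMatrix X := by
      intro X
      ext a b
      simp only [Matrix.smul_apply, Matrix.map_apply, RingHom.mapMatrix_apply, smul_eq_mul, map_mul, map_ofNat]
    rw [h13, h13, map_one] at h12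
    rw [mm, mm, mm]
    exact eq_sub_of_add_eq h12
  · rw [mapRep_apply, mapRep_apply]
    have h13 : ∀ X : Matrix m m W, (X.map φ).trace = φ X.trace := fun X => by simp [Matrix.trace]
    rw [h13, h13, hinv]

end lift2

section lift3
variable {F m H : Type*} [Field F] [Finite F] [Fintype m] [DecidableEq m] [Group H] [Fintype H]

theorem charP_main (p : ℕ) [Fact p.Prime] [CharP F p]
    (hH : (Fintype.card H : F) ≠ 0) (h2 : (2 : F) ≠ 0) (h3 : (3 : F) ≠ 0)
    (ρ : H →* Matrix m m F) (J : Matrix m m F) (hJ : IsUnit J.det)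
    (hform : ∀ g, (ρ g)ᵀ * J * ρ g = J)
    {i j a : H} {P P2 : Matrix m (Fin 2) F} {Q Q2 : Matrix (Fin 2) m F}
    (D : IsQuat ρ i j P Q) (D2 : IsTri ρ a P2 Q2) :
    (P * Q * (P2 * Q2)).trace = 0 ∨ P * Q = P2 * Q2 := by
  let red : WittVector p F →+* F := WittVector.constantCoeff
  have hsurj : Function.Surjective red := WittVector.constantCoeff_surjective p
  have hred : ∀ x, red x ≠ 0 → IsUnit x := fun x hx => WittVector.isUnit_of_coeff_zero_ne_zero x hx
  have hker : ∀ x, red x = 0 → ∃ y, x = (p : WittVector p F) * y := by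
    intro x hx
    have : x ∈ RingHom.ker (WittVector.constantCoeff : WittVector p F →+* F) := hx
    rw [WittVector.ker_constantCoeff, Ideal.mem_span_singleton] at this
    exact this
  have hw : red (p : WittVector p F) = 0 := by simp
  obtain ⟨ρ', hρ⟩ := lift_rep (p : WittVector p F) red hsurj hker hred hw hH ρ
  have hinv := trace_inv_lift red hsurj hred hH ρ ρ' hρ J hJ hform
  let L := AlgebraicClosure (FractionRing (WittVector p F))
  let φ : WittVector p F →+* L := algebraMap _ L
  have hφ : Function.Injective φ := by
    have : φ = (algebraMap (FractionRing (WittVector p F)) L).comp (algebraMap _ _) := IsScalarTower.algebraMap_eq _ _ _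
    rw [this]
    exact (algebraMap (FractionRing (WittVector p F)) L).injective.comp (IsFractionRing.injective _ _)
  have : CharZero (WittVector p F) := by
    apply charZero_of_inj_zero
    intro n hn
    by_contra h0
    obtain ⟨k, u, hu, rfl⟩ := Nat.exists_eq_pow_mul_and_not_dvd h0 p (Fact.out : p.Prime).ne_one
    rw [Nat.cast_mul, Nat.cast_pow, mul_eq_zero] at hn
    rcases hn with hn | hn
    · have h5 : Irreducible (p : WittVector p F) := WittVector.irreducible p
      exact h5.ne_zero (by
        by_contra h6
        exact pow_ne_zero k h6 hn)
    · have := congrArg red hn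
      rw [map_natCast, map_zero, CharP.cast_eq_zero_iff F p] at this
      exact hu this
  have : CharZero L := charZero_of_injective_algebraMap hφ
  obtain ⟨P', Q', hr, D'⟩ := quat_lift red hsurj hred h2 ρ ρ' hρ hinv φ D
  obtain ⟨P2', Q2', hr2, D2'⟩ := tri_lift red hsurj hred h3 ρ ρ' hρ hinv φ D2
  have mi : Function.Injective (fun X : Matrix m m (WittVector p F) => X.map φ) := Matrix.map_injective hφ
  rcases charZero_main D' D2' with h | h
  · left
    rw [← Matrix.map_mul, ← Matrix.map_mul, ← Matrix.map_mul] at h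
    have h13 : (P' * Q' * (P2' * Q2')).trace = 0 := by
      apply hφ
      have h14 : ∀ X : Matrix m m (WittVector p F), (X.map φ).trace = φ X.trace := fun X => by simp [Matrix.trace]
      rw [map_zero, ← h, h14]
    rw [← hr, ← hr2, ← Matrix.map_mul]
    have h14 : ∀ X : Matrix m m (WittVector p F), (X.map red).trace = red X.trace := fun X => by simp [Matrix.trace]
    rw [h14, h13, map_zero]
  · right
    rw [← Matrix.map_mul, ← Matrix.map_mul] at h
    rw [← hr, ← hr2, mi h]
end lift3

section blk
variable {F l : Type*} [Field F] [Fintype l] [DecidableEq l]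

/-- the block embedding of a family of 2 × 2 matrices -/
def blk : (l → Matrix (Fin 2) (Fin 2) F) →+* Matrix (l ⊕ l) (l ⊕ l) F where
  toFun S := fromBlocks (diagonal fun i => S i 0 0) (diagonal fun i => S i 0 1)
    (diagonal fun i => S i 1 0) (diagonal fun i => S i 1 1)
  map_one' := by
    rw [← fromBlocks_one]; simp
  map_mul' S T := by
    rw [fromBlocks_multiply]
    simp [mul_apply, Fin.sum_univ_two, diagonal_mul_diagonal]
  map_zero' := by
    simp
  map_add' S T := by
    rw [fromBlocks_add]; simp

theorem blk_def (S : l → Matrix (Fin 2) (Fin 2) F) : blk S = fromBlocks (diagonal fun i => S i 0 0) (diagonal fun i => S i 0 1)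
    (diagonal fun i => S i 1 0) (diagonal fun i => S i 1 1) := rfl

theorem blk_inj : Function.Injective (blk : (l → Matrix (Fin 2) (Fin 2) F) → _) := by
  intro S T h
  rw [blk_def, blk_def, fromBlocks_inj] at h
  obtain ⟨h1, h2, h3, h4⟩ := h
  have := fun i => congrFun (diagonal_injective h1) i
  have := fun i => congrFun (diagonal_injective h2) i
  have := fun i => congrFun (diagonal_injective h3) i
  have := fun i => congrFun (diagonal_injective h4) i
  funext i
  ext a b
  fin_cases a <;> fin_cases b <;> simp_all

theorem blk_transpose (S : l → Matrix (Fin 2) (Fin 2) F) : (blk S)ᵀ = blk (fun i => (S i)ᵀ) := by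
  rw [blk_def, blk_def, fromBlocks_transpose]; simp

theorem J_eq_blk : Matrix.J l F = blk (fun _ => !![0, -1; 1, 0]) := by
  rw [blk_def, Matrix.J]; simp
  ext a b; simp [diagonal_apply, one_apply]; split_ifs <;> simp

theorem m2_symp (S : Matrix (Fin 2) (Fin 2) F) : S * !![0, -1; 1, 0] * Sᵀ = S.det • !![0, -1; 1, 0] := by
  ext a b
  fin_cases a <;> fin_cases b <;> simp [mul_apply, Fin.sum_univ_two, det_fin_two] <;> ring

theorem blk_mem (S : l → Matrix (Fin 2) (Fin 2) F) :
    blk S ∈ symplecticGroup l F ↔ ∀ i, (S i).det = 1 := by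
  rw [SymplecticGroup.mem_iff, J_eq_blk, blk_transpose, ← map_mul, ← map_mul, blk_inj.eq_iff, funext_iff]
  refine forall_congr' fun i => ?_
  simp only [Pi.mul_apply, m2_symp]
  constructor
  · intro h
    have := congrFun (congrFun h 1) 0
    simpa using this
  · intro h; rw [h, one_smul]

def embSL : (l → SpecialLinearGroup (Fin 2) F) →* symplecticGroup l F where
  toFun S := ⟨blk (fun i => (S i).1), (blk_mem _).2 fun i => (S i).2⟩
  map_one' := by
    apply Subtype.ext
    exact map_one blk
  map_mul' S T := by
    apply Subtype.ext
    exact map_mul blk _ _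

theorem embSL_coe (S : l → SpecialLinearGroup (Fin 2) F) : (embSL S).1 = blk (fun i => (S i).1) := rfl

theorem embSL_inj : Function.Injective (embSL : (l → SpecialLinearGroup (Fin 2) F) → _) := by
  intro S T h
  have h1 := blk_inj (congrArg Subtype.val h)
  funext i
  exact Subtype.ext (congrFun h1 i)

def Pm (i : l) : Matrix (l ⊕ l) (Fin 2) F := of fun a b =>
  Sum.elim (fun k => if k = i then (![1, 0] : Fin 2 → F) b else 0) (fun k => if k = i then (![0, 1] : Fin 2 → F) b else 0) a

def Em (i : l) : Matrix (l ⊕ l) (l ⊕ l) F := blk (Pi.single i 1)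

theorem PXQ (i : l) (X : Matrix (Fin 2) (Fin 2) F) :
    (Pm i : Matrix (l ⊕ l) (Fin 2) F) * X * (Pm i : Matrix (l ⊕ l) (Fin 2) F)ᵀ = blk (Pi.single i X) := by
  rw [blk_def]
  ext a b
  rcases a with a | a <;> rcases b with b | b <;> by_cases h : a = i <;> by_cases h' : b = i <;>
    simp [Pm, mul_apply, Fin.sum_univ_two, diagonal_apply, Pi.single_apply, h, h'] <;> aesop

theorem QSP (i : l) (S : l → Matrix (Fin 2) (Fin 2) F) :
    (Pm i : Matrix (l ⊕ l) (Fin 2) F)ᵀ * blk S * (Pm i : Matrix (l ⊕ l) (Fin 2) F) = S i := by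
  rw [blk_def]
  ext a b
  fin_cases a <;> fin_cases b <;>
    simp [Pm, mul_apply, Fintype.sum_sum_type, diagonal_apply]

theorem PQ_E (i : l) :
    (Pm i : Matrix (l ⊕ l) (Fin 2) F) * (Pm i : Matrix (l ⊕ l) (Fin 2) F)ᵀ = Em i := by
  rw [Em, ← PXQ, Matrix.mul_one]

theorem QP_one (i : l) :
    (Pm i : Matrix (l ⊕ l) (Fin 2) F)ᵀ * (Pm i : Matrix (l ⊕ l) (Fin 2) F) = 1 := by
  have := QSP (F := F) i (1 : l → Matrix (Fin 2) (Fin 2) F)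
  rwa [map_one, Matrix.mul_one] at this

theorem E_trace (i : l) : (Em i : Matrix _ _ F).trace = 2 := by
  rw [← PQ_E, Matrix.trace_mul_comm, QP_one]; simp

theorem E_sum : ∑ i, (Em i : Matrix (l ⊕ l) (l ⊕ l) F) = 1 := by
  simp only [Em]
  rw [← map_sum]
  have := Finset.univ_sum_single (1 : l → Matrix (Fin 2) (Fin 2) F)
  simp only [Pi.one_apply] at this
  rw [this, map_one]

theorem E_inj : Function.Injective (Em : l → Matrix (l ⊕ l) (l ⊕ l) F) := by
  intro i j h
  have h1 := congrFun (blk_inj h) i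
  by_contra hne
  rw [Pi.single_eq_same, Pi.single_eq_of_ne hne] at h1
  exact one_ne_zero h1

theorem E_comm_blk (g : Matrix (l ⊕ l) (l ⊕ l) F) (h : ∀ i, g * Em i = Em i * g) :
    ∃ S, g = blk S := by
  refine ⟨fun i => (Pm i : Matrix (l ⊕ l) (Fin 2) F)ᵀ * g * (Pm i : Matrix (l ⊕ l) (Fin 2) F), ?_⟩
  have h1 : g = ∑ i, Em i * g * Em i := by
    have h2 : ∀ i, Em i * g * Em i = g * Em i := by
      intro i
      rw [← h, mul_assoc]; congr 1
      simp only [Em]; rw [← map_mul, ← Pi.single_mul, one_mul]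
    simp only [h2]
    rw [← Finset.mul_sum, E_sum, mul_one]
  conv_lhs => rw [h1]
  rw [← Finset.univ_sum_single (fun i => (Pm i : Matrix (l ⊕ l) (Fin 2) F)ᵀ * g * (Pm i : Matrix (l ⊕ l) (Fin 2) F)), map_sum]
  refine Finset.sum_congr rfl fun i _ => ?_
  rw [← PXQ, ← PQ_E]
  simp only [Matrix.mul_assoc]

end blk

section hall
variable {π : Set ℕ} {G K : Type*} [Group G] [Group K]

theorem pi_dvd {a b : ℕ} (h : a ∣ b) (hb : IsPiNumber π b) : IsPiNumber π a :=
  fun p hp hd => hb p hp (hd.trans h)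

theorem hall_map {H : Subgroup G} (hH : IsHallPi π H) (f : G →* K) (hf : Function.Surjective f) :
    IsHallPi π (H.map f) :=
  ⟨pi_dvd (Subgroup.card_map_dvd H f) hH.1, fun p hp hpp hd => hH.2 p hp hpp (hd.trans (Subgroup.index_map_dvd H hf))⟩

theorem hall_sub {H M : Subgroup G} (hH : IsHallPi π H) (h : H ≤ M) : IsHallPi π (H.subgroupOf M) := by
  refine ⟨?_, fun p hp hpp hd => hH.2 p hp hpp (hd.trans (Subgroup.relIndex_dvd_index_of_le h))⟩
  rw [Nat.card_congr (Subgroup.subgroupOfEquivOfLe h).toEquiv]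
  exact hH.1

theorem hall_normal [Finite G] {H N : Subgroup G} [N.Normal] (hH : IsHallPi π H) : IsHallPi π (H.subgroupOf N) := by
  constructor
  · refine pi_dvd ?_ hH.1
    have : (H.subgroupOf N).map N.subtype ≤ H := by
      rw [Subgroup.subgroupOf_map_subtype]; exact inf_le_left
    have h2 := Subgroup.card_dvd_of_le this
    rwa [Subgroup.card_map_of_injective N.subtype_injective] at h2
  · intro p hp hpp hd
    apply hH.2 p hp hpp
    have h1 : H.relIndex N = H.relIndex (H ⊔ N) := by
      have e1 : (H ⊓ N).relIndex H * H.relIndex (H ⊔ N) = (H ⊓ N).relIndex (H ⊔ N) :=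
        Subgroup.relIndex_mul_relIndex _ _ _ inf_le_left le_sup_left
      have e2 : (H ⊓ N).relIndex N * N.relIndex (H ⊔ N) = (H ⊓ N).relIndex (H ⊔ N) :=
        Subgroup.relIndex_mul_relIndex _ _ _ inf_le_right le_sup_right
      rw [Subgroup.inf_relIndex_left] at e1
      rw [Subgroup.inf_relIndex_right, Subgroup.relIndex_sup_right] at e2
      have e3 : N.relIndex H ≠ 0 := Subgroup.index_ne_zero_of_finite
      apply Nat.eq_of_mul_eq_mul_left (Nat.pos_of_ne_zero e3)
      rw [e1, ← e2, mul_comm]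
    have h2 : H.relIndex N ∣ H.index := by
      rw [h1]; exact Subgroup.relIndex_dvd_index_of_le le_sup_left
    exact hd.trans h2

theorem hall_conj {H : Subgroup G} (hH : IsHallPi π H) (g : G) : IsHallPi π (H.map (MulAut.conj g).toMonoidHom) :=
  hall_map hH _ (MulAut.conj g).surjective

theorem hall_fix [Finite G] {H : Subgroup G} (hH : IsHallPi π H) {r : ℕ} (hr : r ∈ π) (hrp : r.Prime) (R : Subgroup G)
    (hR : IsPGroup r R) : ∃ g : G, ∀ x ∈ R, g⁻¹ * x * g ∈ H := by
  have := Fact.mk hrp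
  obtain ⟨y, hy⟩ := hR.nonempty_fixed_point_of_prime_not_dvd_card (G ⧸ H) (hH.2 r hr hrp)
  obtain ⟨g, rfl⟩ := QuotientGroup.mk_surjective y
  refine ⟨g, fun x hx => ?_⟩
  have h1 := hy ⟨x, hx⟩
  have h2 : ((x * g : G) : G ⧸ H) = (g : G ⧸ H) := h1
  have h3 := QuotientGroup.eq.1 h2.symm
  simpa [mul_assoc] using h3

theorem pi_pgroup {l : Type*} {r : ℕ} [Fact r.Prime] [Finite K] (Q : Subgroup K) (hQ : IsPGroup r Q) :
    IsPGroup r (Subgroup.pi Set.univ (fun _ : l => Q)) := by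
  obtain ⟨k, hk⟩ := IsPGroup.iff_card.1 hQ
  rintro ⟨f, hf⟩
  refine ⟨k, ?_⟩
  apply Subtype.ext
  funext i
  have h1 : f i ∈ Q := hf i trivial
  have h2 : (⟨f i, h1⟩ : Q) ^ (r ^ k) = 1 := by rw [← hk]; exact pow_card_eq_one'
  exact congrArg Subtype.val h2

theorem zpowers_pgroup {r k : ℕ} (x : G) (hx : x ^ (r ^ k) = 1) : IsPGroup r (Subgroup.zpowers x) := by
  rintro ⟨y, hy⟩
  obtain ⟨z, rfl⟩ := Subgroup.mem_zpowers_iff.1 hy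
  refine ⟨k, ?_⟩
  apply Subtype.ext
  change (x ^ z) ^ (r ^ k) = 1
  rw [← zpow_natCast, ← _root_.zpow_mul, mul_comm, _root_.zpow_mul, zpow_natCast, hx, _root_.one_zpow]

theorem quat_pgroup {I J : G} (hI : I ^ 4 = 1) (hJ : J ^ 4 = 1) (hc : J * I * J⁻¹ = I⁻¹) :
    ∃ Q : Subgroup G, IsPGroup 2 Q ∧ I ∈ Q ∧ J ∈ Q := by
  refine ⟨Subgroup.zpowers J ⊔ Subgroup.zpowers I, ?_, ?_, ?_⟩
  · apply IsPGroup.to_sup_of_normal_right' (zpowers_pgroup (k := 2) J hJ) (zpowers_pgroup (k := 2) I hI)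
    rw [Subgroup.zpowers_le]
    rw [Subgroup.mem_normalizer_iff]
    intro h
    constructor
    · intro hh
      obtain ⟨z, rfl⟩ := Subgroup.mem_zpowers_iff.1 hh
      rw [← conj_zpow, hc]
      exact Subgroup.zpow_mem _ (inv_mem (Subgroup.mem_zpowers I)) z
    · intro hh
      obtain ⟨z, hz⟩ := Subgroup.mem_zpowers_iff.1 hh
      have hc' : I = J⁻¹ * I⁻¹ * J := by rw [← hc]; group
      have : h = J⁻¹ * I ^ z * J := by rw [hz]; group
      rw [this]
      have h4 : J⁻¹ * I ^ z * (J⁻¹)⁻¹ = (J⁻¹ * I * (J⁻¹)⁻¹) ^ z := (conj_zpow).symm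
      rw [inv_inv] at h4
      rw [h4]
      apply Subgroup.zpow_mem
      have h5 : J⁻¹ * I * J = I⁻¹ := by
        have := congrArg (·⁻¹) hc'
        simpa [mul_assoc] using this.symm
      rw [h5]
      exact inv_mem (Subgroup.mem_zpowers I)
  · exact (le_sup_right : _ ≤ Subgroup.zpowers J ⊔ Subgroup.zpowers I) (Subgroup.mem_zpowers I)
  · exact (le_sup_left : _ ≤ Subgroup.zpowers J ⊔ Subgroup.zpowers I) (Subgroup.mem_zpowers J)

end hall

section frame
variable {F l : Type*} [Field F] [Fintype l] [DecidableEq l]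

def slI : SpecialLinearGroup (Fin 2) F := ⟨!![0, 1; -1, 0], by simp⟩
def slJ (x y : F) (h : x ^ 2 + y ^ 2 = -1) : SpecialLinearGroup (Fin 2) F :=
  ⟨!![x, y; y, -x], by simp; linear_combination -h⟩
def slA : SpecialLinearGroup (Fin 2) F := ⟨!![0, -1; 1, -1], by simp⟩

theorem slI_sq : (slI : SpecialLinearGroup (Fin 2) F) * slI = -1 := by
  apply Subtype.ext
  simp only [Matrix.SpecialLinearGroup.coe_mul, Matrix.SpecialLinearGroup.coe_neg, Matrix.SpecialLinearGroup.coe_one]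
  simp [slI, ← Matrix.ext_iff, Fin.forall_fin_two]

theorem slJ_sq (x y : F) (h : x ^ 2 + y ^ 2 = -1) : slJ x y h * slJ x y h = -1 := by
  apply Subtype.ext
  simp only [Matrix.SpecialLinearGroup.coe_mul, Matrix.SpecialLinearGroup.coe_neg, Matrix.SpecialLinearGroup.coe_one]
  simp [slJ, ← Matrix.ext_iff, Fin.forall_fin_two]
  refine ⟨⟨?_, ?_⟩, ?_, ?_⟩
  · linear_combination h
  · ring
  · ring
  · linear_combination h

theorem slJI (x y : F) (h : x ^ 2 + y ^ 2 = -1) : slJ x y h * slI = -1 * (slI * slJ x y h) := by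
  apply Subtype.ext
  simp only [Matrix.SpecialLinearGroup.coe_mul, Matrix.SpecialLinearGroup.coe_neg, Matrix.SpecialLinearGroup.coe_one]
  simp [slJ, slI, ← Matrix.ext_iff, Fin.forall_fin_two]

theorem slA_cube : (slA : SpecialLinearGroup (Fin 2) F) * slA * slA = 1 := by
  apply Subtype.ext
  simp only [Matrix.SpecialLinearGroup.coe_mul, Matrix.SpecialLinearGroup.coe_neg, Matrix.SpecialLinearGroup.coe_one]
  simp [slA, ← Matrix.ext_iff, Fin.forall_fin_two]

theorem slA_sum : 1 + (slA : SpecialLinearGroup (Fin 2) F).1 + slA.1 * slA.1 = 0 := by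
  simp [slA, ← Matrix.ext_iff, Fin.forall_fin_two]

theorem emb_single (i : l) (X : SpecialLinearGroup (Fin 2) F) :
    (embSL (Pi.mulSingle i X) : symplecticGroup l F).1 = 1 + blk (Pi.single i (X.1 - 1)) := by
  rw [embSL_coe, ← map_one blk, ← map_add]
  congr 1
  funext k
  by_cases h : k = i
  · subst h; simp
  · simp [Pi.mulSingle_eq_of_ne h, Pi.single_eq_of_ne h]

/-- inclusion representation -/
def incl (H : Subgroup (symplecticGroup l F)) : H →* Matrix (l ⊕ l) (l ⊕ l) F :=
  (symplecticGroup l F).subtype.comp H.subtype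

theorem incl_form (H : Subgroup (symplecticGroup l F)) (g : H) : (incl H g)ᵀ * Matrix.J l F * incl H g = Matrix.J l F :=
  SymplecticGroup.mem_iff'.1 g.1.2

theorem incl_inv (H : Subgroup (symplecticGroup l F)) (g : H) : (incl H g⁻¹).trace = (incl H g).trace :=
  trace_inv_of_form (incl H) (Matrix.J l F) (isUnit_det_J l F) (incl_form H) g

theorem frame_quat (H : Subgroup (symplecticGroup l F)) (i : l) (x y : F) (h : x ^ 2 + y ^ 2 = -1)
    (hI : embSL (Pi.mulSingle i slI) ∈ H) (hJ : embSL (Pi.mulSingle i (slJ x y h)) ∈ H) :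
    IsQuat (incl H) ⟨_, hI⟩ ⟨_, hJ⟩ (Pm (F := F) i) (Pm (F := F) i)ᵀ := by
  have hcoe : ∀ X : SpecialLinearGroup (Fin 2) F, ∀ hX : embSL (Pi.mulSingle i X) ∈ H,
      incl H ⟨_, hX⟩ = 1 + Pm (F := F) i * ((Pm (F := F) i)ᵀ * incl H ⟨_, hX⟩ * Pm (F := F) i - 1) * (Pm (F := F) i)ᵀ := by
    intro X hX
    have h1 : incl H ⟨_, hX⟩ = (embSL (Pi.mulSingle i X) : symplecticGroup l F).1 := rfl
    rw [h1]
    conv_lhs => rw [emb_single]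
    rw [embSL_coe, QSP, PXQ]
    simp
  refine ⟨?_, ?_, ?_, QP_one i, ?_, hcoe _ _, hcoe _ _, incl_inv H⟩
  · apply Subtype.ext
    simp only [Subgroup.coe_mul, ← map_mul, ← Pi.mulSingle_mul, slI_sq, slJ_sq]
  · apply Subtype.ext
    simp only [Subgroup.coe_mul, ← map_mul, ← Pi.mulSingle_mul, slI_sq]
    simp
  · apply Subtype.ext
    simp only [Subgroup.coe_mul, ← map_mul, ← Pi.mulSingle_mul, slI_sq, slJI]
  · have h1 : incl H (⟨_, hI⟩ * ⟨_, hI⟩) = (embSL (Pi.mulSingle i (-1)) : symplecticGroup l F).1 := by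
      change ((embSL (Pi.mulSingle i slI) * embSL (Pi.mulSingle i slI) : symplecticGroup l F)).1 = _
      rw [← map_mul, ← Pi.mulSingle_mul, slI_sq]
    rw [h1, emb_single, PQ_E, Em]
    have h2 : ((-1 : SpecialLinearGroup (Fin 2) F).1 - 1) = -(1 + 1) := by
      rw [Matrix.SpecialLinearGroup.coe_neg, Matrix.SpecialLinearGroup.coe_one]; abel
    rw [h2, Pi.single_neg, map_neg]
    rw [Pi.single_add, map_add]
    module

theorem frame_tri (H : Subgroup (symplecticGroup l F)) (j : l) (w : symplecticGroup l F)
    (hA : w * embSL (Pi.mulSingle j slA) * w⁻¹ ∈ H) :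
    IsTri (incl H) ⟨_, hA⟩ (w.1 * Pm (F := F) j) ((Pm (F := F) j)ᵀ * (w⁻¹).1) := by
  have hw1 : (w⁻¹).1 * w.1 = 1 := congrArg Subtype.val (inv_mul_cancel w)
  have hw2 : w.1 * (w⁻¹).1 = 1 := congrArg Subtype.val (mul_inv_cancel w)
  refine ⟨?_, ?_, ?_, incl_inv H _⟩
  · apply Subtype.ext
    simp only [Subgroup.coe_mul, Subgroup.coe_one]
    have : w * embSL (Pi.mulSingle j slA) * w⁻¹ * (w * embSL (Pi.mulSingle j slA) * w⁻¹) * (w * embSL (Pi.mulSingle j slA) * w⁻¹)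
      = w * (embSL (Pi.mulSingle j slA) * embSL (Pi.mulSingle j slA) * embSL (Pi.mulSingle j slA)) * w⁻¹ := by group
    rw [this, ← map_mul, ← map_mul, ← Pi.mulSingle_mul, ← Pi.mulSingle_mul, slA_cube]
    simp
  · rw [Matrix.mul_assoc, ← Matrix.mul_assoc (w⁻¹).1, hw1, Matrix.one_mul, QP_one]
  · have h1 : incl H ⟨_, hA⟩ = w.1 * (1 + blk (Pi.single j (slA.1 - 1))) * (w⁻¹).1 := by
      rw [← emb_single]; rfl
    have h2 : incl H (⟨_, hA⟩ * ⟨_, hA⟩) = w.1 * (1 + blk (Pi.single j (slA.1 * slA.1 - 1))) * (w⁻¹).1 := by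
      have h3 : slA.1 * slA.1 = (slA * slA : SpecialLinearGroup (Fin 2) F).1 := rfl
      rw [h3, ← emb_single, Pi.mulSingle_mul, map_mul embSL]
      change (w * embSL (Pi.mulSingle j slA) * w⁻¹ * (w * embSL (Pi.mulSingle j slA) * w⁻¹)).1
        = (w * (embSL (Pi.mulSingle j slA) * embSL (Pi.mulSingle j slA)) * w⁻¹).1
      congr 1; group
    have h4 : (slA : SpecialLinearGroup (Fin 2) F).1 * slA.1 = -1 - slA.1 := by
      have h7 := eq_neg_of_add_eq_zero_right (slA_sum (F := F))
      rw [h7]; abel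
    rw [h1, h2, h4]
    have h5 : w.1 * Pm (F := F) j * ((Pm (F := F) j)ᵀ * (w⁻¹).1) = w.1 * Em j * (w⁻¹).1 := by
      rw [← PQ_E]; simp only [Matrix.mul_assoc]
    rw [h5, Em]
    have h6 : (1 : Matrix (l ⊕ l) (l ⊕ l) F) = w.1 * 1 * (w⁻¹).1 := by rw [mul_one, hw2]
    conv_rhs => rw [h6]
    simp only [Pi.single_sub, Pi.single_neg, map_sub, map_neg, mul_add, add_mul, mul_sub, sub_mul, mul_neg, neg_mul, mul_one, hw2]
    module

theorem frame_main [Finite F] (p : ℕ) [Fact p.Prime] [CharP F p] (H : Subgroup (symplecticGroup l F))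
    (hH : (Nat.card H : F) ≠ 0) (h2 : (2 : F) ≠ 0) (h3 : (3 : F) ≠ 0)
    (x y : F) (h : x ^ 2 + y ^ 2 = -1)
    (hI : ∀ i, embSL (Pi.mulSingle i slI) ∈ H) (hJ : ∀ i, embSL (Pi.mulSingle i (slJ x y h)) ∈ H)
    (w : symplecticGroup l F) (j : l) (hA : w * embSL (Pi.mulSingle j slA) * w⁻¹ ∈ H) :
    ∃ i, w.1 * Em j = Em i * w.1 := by
  have hw1 : (w⁻¹).1 * w.1 = 1 := congrArg Subtype.val (inv_mul_cancel w)
  have h5 : w.1 * Pm (F := F) j * ((Pm (F := F) j)ᵀ * (w⁻¹).1) = w.1 * Em j * (w⁻¹).1 := by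
    rw [← PQ_E]; simp only [Matrix.mul_assoc]
  have := Fintype.ofFinite F
  have := Fintype.ofFinite H
  rw [Nat.card_eq_fintype_card] at hH
  have key : ∀ i, (Em i * (w.1 * Em j * (w⁻¹).1)).trace = 0 ∨ Em i = w.1 * Em j * (w⁻¹).1 := by
    intro i
    have := charP_main p hH h2 h3 (incl H) (Matrix.J l F) (isUnit_det_J l F) (incl_form H)
      (frame_quat H i x y h (hI i) (hJ i)) (frame_tri H j w hA)
    rwa [h5, PQ_E] at this
  by_contra hne
  push Not at hne
  have key2 : ∀ i, (Em i * (w.1 * Em j * (w⁻¹).1)).trace = 0 := by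
    intro i
    refine (key i).resolve_right fun hh => hne i ?_
    rw [hh, mul_assoc, hw1, mul_one]
  have : ∑ i, (Em i * (w.1 * Em j * (w⁻¹).1)).trace = 2 := by
    rw [← Matrix.trace_sum, ← Finset.sum_mul, E_sum, one_mul, Matrix.trace_mul_comm, ← mul_assoc, hw1, one_mul, E_trace]
  simp only [key2, Finset.sum_const_zero] at this
  exact h2 this.symm

end frame

section mon
variable {F l : Type*} [Field F] [Fintype l] [DecidableEq l]

theorem val_cancel (w : symplecticGroup l F) {X Y : Matrix (l ⊕ l) (l ⊕ l) F} (h : X * w.1 = Y * w.1) : X = Y := by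
  have hw2 : w.1 * (w⁻¹).1 = 1 := congrArg Subtype.val (mul_inv_cancel w)
  have := congrArg (· * (w⁻¹).1) h
  simpa only [mul_assoc, hw2, mul_one] using this

theorem val_cancel_left (w : symplecticGroup l F) {X Y : Matrix (l ⊕ l) (l ⊕ l) F} (h : w.1 * X = w.1 * Y) : X = Y := by
  have hw2 : (w⁻¹).1 * w.1 = 1 := congrArg Subtype.val (inv_mul_cancel w)
  have := congrArg ((w⁻¹).1 * ·) h
  simpa only [← mul_assoc, hw2, one_mul] using this

variable (F l) in
/-- the monomial subgroup permuting the coordinate planes -/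
def Mon : Subgroup (symplecticGroup l F) where
  carrier := {g | ∀ i, ∃ k, g.1 * Em i = Em k * g.1}
  one_mem' := fun i => ⟨i, by simp⟩
  mul_mem' := by
    intro g h hg hh i
    obtain ⟨k, hk⟩ := hh i
    obtain ⟨m, hm⟩ := hg k
    refine ⟨m, ?_⟩
    change g.1 * h.1 * _ = _ * (g.1 * h.1)
    rw [mul_assoc, hk, ← mul_assoc, hm, mul_assoc]
  inv_mem' := by
    intro g hg
    choose τ hτ using hg
    have hinj : Function.Injective τ := by
      intro i j hij
      have h1 := hτ i
      rw [hij, ← hτ j] at h1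
      exact E_inj (val_cancel_left g h1)
    have hsurj := Finite.injective_iff_surjective.1 hinj
    intro k
    obtain ⟨i, rfl⟩ := hsurj k
    refine ⟨i, ?_⟩
    have hw1 : (g⁻¹).1 * g.1 = 1 := congrArg Subtype.val (inv_mul_cancel g)
    have hw2 : g.1 * (g⁻¹).1 = 1 := congrArg Subtype.val (mul_inv_cancel g)
    calc (g⁻¹).1 * Em (τ i) = (g⁻¹).1 * (Em (τ i) * g.1) * (g⁻¹).1 := by
          rw [mul_assoc, mul_assoc, hw2, mul_one]
      _ = Em i * (g⁻¹).1 := by rw [← hτ i, ← mul_assoc, hw1, one_mul]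

noncomputable def tau (g : Mon F l) (i : l) : l := Classical.choose (g.2 i)

theorem tau_spec (g : Mon F l) (i : l) : g.1.1 * Em i = Em (tau g i) * g.1.1 := Classical.choose_spec (g.2 i)

theorem tau_unique (g : Mon F l) {i k : l} (h : g.1.1 * Em i = Em k * g.1.1) : tau g i = k := by
  rw [tau_spec] at h
  exact E_inj (val_cancel g.1 h)

variable (F l) in
noncomputable def theta : Mon F l →* Equiv.Perm l :=
  MonoidHom.toHomPerm
    { toFun := fun g => (tau g : Function.End l)
      map_one' := by
        funext i
        exact tau_unique (k := i) 1 (by simp)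
      map_mul' := by
        intro g h
        funext i
        apply tau_unique
        change g.1.1 * h.1.1 * _ = Em (tau g (tau h i)) * (g.1.1 * h.1.1)
        rw [mul_assoc, tau_spec, ← mul_assoc, tau_spec, mul_assoc] }

theorem theta_apply (g : Mon F l) (i : l) : theta F l g i = tau g i := rfl

theorem Em_blocks (i : l) : (Em i : Matrix (l ⊕ l) (l ⊕ l) F) = fromBlocks (diagonal (Pi.single i 1)) 0 0 (diagonal (Pi.single i 1)) := by
  rw [Em, blk_def]
  congr 1
  · congr 1; funext k; by_cases h : k = i
    · subst h; simp
    · simp [Pi.single_eq_of_ne h]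
  · ext a b; by_cases h : a = i
    · subst h; simp [diagonal_apply]
    · simp [diagonal_apply, Pi.single_eq_of_ne h]
  · ext a b; by_cases h : a = i
    · subst h; simp [diagonal_apply]
    · simp [diagonal_apply, Pi.single_eq_of_ne h]
  · congr 1; funext k; by_cases h : k = i
    · subst h; simp
    · simp [Pi.single_eq_of_ne h]

theorem theta_surj : Function.Surjective (theta F l) := by
  intro σ
  have hmem : fromBlocks (Equiv.Perm.permMatrix F σ⁻¹) 0 0 (Equiv.Perm.permMatrix F σ⁻¹) ∈ symplecticGroup l F := by
    rw [SymplecticGroup.fromBlocks_mem_iff]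
    simp [Matrix.transpose_permMatrix, ← Matrix.permMatrix_mul]
  have hk : ∀ i, (fromBlocks (Equiv.Perm.permMatrix F σ⁻¹) 0 0 (Equiv.Perm.permMatrix F σ⁻¹)) * Em i
      = Em (σ i) * (fromBlocks (Equiv.Perm.permMatrix F σ⁻¹) 0 0 (Equiv.Perm.permMatrix F σ⁻¹)) := by
    intro i
    rw [Em_blocks, Em_blocks, fromBlocks_multiply, fromBlocks_multiply]
    have : (Equiv.Perm.permMatrix F σ⁻¹) * diagonal (Pi.single i 1) = diagonal (Pi.single (σ i) 1) * (Equiv.Perm.permMatrix F σ⁻¹) := by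
      ext a b
      rw [mul_diagonal, diagonal_mul]
      by_cases h : σ⁻¹ a = b
      · subst h
        by_cases h2 : a = σ i
        · subst h2; simp
        · have : σ⁻¹ a ≠ i := by rintro rfl; simp at h2
          rw [Pi.single_eq_of_ne h2, Pi.single_eq_of_ne this]; simp
      · have : Equiv.Perm.permMatrix F σ⁻¹ a b = 0 := by
          simp [Equiv.Perm.permMatrix, PEquiv.toMatrix_apply, Equiv.toPEquiv_apply]
          exact h
        rw [this]; simp
    simp [this]
  refine ⟨⟨⟨_, hmem⟩, fun i => ⟨σ i, hk i⟩⟩, ?_⟩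
  ext i
  rw [theta_apply]
  exact tau_unique _ (hk i)

theorem emb_mem_Mon (S : l → SpecialLinearGroup (Fin 2) F) : embSL S ∈ Mon F l := by
  intro i
  refine ⟨i, ?_⟩
  rw [embSL_coe, Em, ← map_mul, ← map_mul]
  congr 1
  funext k
  by_cases h : k = i
  · subst h; simp
  · simp [Pi.single_eq_of_ne h]

variable (F l) in
def embMon : (l → SpecialLinearGroup (Fin 2) F) →* Mon F l :=
  embSL.codRestrict (Mon F l) emb_mem_Mon

theorem embMon_inj : Function.Injective (embMon F l) := by
  intro S T h
  exact embSL_inj (congrArg Subtype.val h)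

theorem embMon_range : (embMon F l).range = (theta F l).ker := by
  ext g
  constructor
  · rintro ⟨S, rfl⟩
    rw [MonoidHom.mem_ker]
    ext i
    rw [theta_apply]
    apply tau_unique
    change (embSL S).1 * _ = _ * (embSL S).1
    rw [embSL_coe, Equiv.Perm.one_apply, Em, ← map_mul, ← map_mul]
    congr 1
    funext k
    by_cases h : k = i
    · subst h; simp
    · simp [Pi.single_eq_of_ne h]
  · intro hg
    rw [MonoidHom.mem_ker] at hg
    have h1 : ∀ i, g.1.1 * Em i = Em i * g.1.1 := by
      intro i
      have h2 := tau_spec g i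
      rw [← theta_apply, hg] at h2
      exact h2
    obtain ⟨S, hS⟩ := E_comm_blk _ h1
    have h3 := g.1.2
    rw [hS, blk_mem] at h3
    refine ⟨fun i => ⟨S i, h3 i⟩, ?_⟩
    apply Subtype.ext
    apply Subtype.ext
    exact hS.symm

theorem mon_hall [Finite F] {π : Set ℕ} (i0 : l) (H : Subgroup (symplecticGroup l F)) (hH : IsHallPi π H) (hM : H ≤ Mon F l) :
    (∃ H : Subgroup (Equiv.Perm l), IsHallPi π H) ∧
    (∃ H : Subgroup (SpecialLinearGroup (Fin 2) F), IsHallPi π H) := by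
  have h1 := hall_sub hH hM
  refine ⟨⟨_, hall_map h1 (theta F l) theta_surj⟩, ?_⟩
  have hN : ((embMon F l).range).Normal := by rw [embMon_range]; infer_instance
  have h2 : IsHallPi π ((H.subgroupOf (Mon F l)).subgroupOf (embMon F l).range) := hall_normal h1
  let e := MonoidHom.ofInjective (embMon_inj (F := F) (l := l))
  refine ⟨_, hall_map h2 ((Pi.evalMonoidHom (fun _ : l => SpecialLinearGroup (Fin 2) F) i0).comp e.symm.toMonoidHom) ?_⟩
  intro x
  refine ⟨e (fun _ => x), ?_⟩
  simp

end mon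

section red
variable {F l : Type*} [Field F] [Fintype l] [DecidableEq l]

theorem hall_in_mon [Finite F] {π : Set ℕ} (h2 : 2 ∈ π) (h3 : 3 ∈ π) (hp : ringChar F ∉ π)
    (H : Subgroup (symplecticGroup l F)) (hH : IsHallPi π H) :
    ∃ H' : Subgroup (symplecticGroup l F), IsHallPi π H' ∧ H' ≤ Mon F l := by
  have hpp : (ringChar F).Prime := CharP.char_is_prime F (ringChar F)
  have : Fact (ringChar F).Prime := ⟨hpp⟩
  have hne : ∀ m : ℕ, IsPiNumber π m → (m : F) ≠ 0 := by
    intro m hm h0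
    rw [CharP.cast_eq_zero_iff F (ringChar F)] at h0
    exact hp (hm _ hpp h0)
  have h2F : (2 : F) ≠ 0 := by
    have := hne 2 (fun r hr hd => by rwa [(Nat.prime_dvd_prime_iff_eq hr Nat.prime_two).1 hd])
    exact_mod_cast this
  have h3F : (3 : F) ≠ 0 := by
    have := hne 3 (fun r hr hd => by rwa [(Nat.prime_dvd_prime_iff_eq hr Nat.prime_three).1 hd])
    exact_mod_cast this
  obtain ⟨x, y, hxy⟩ : ∃ x y : F, x ^ 2 + y ^ 2 = -1 := by
    obtain ⟨a, b, hab⟩ := CharP.sq_add_sq F (ringChar F) (-1)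
    exact ⟨a, b, by rw [hab]; simp⟩
  have : Finite (SpecialLinearGroup (Fin 2) F) := inferInstance
  have : Finite (symplecticGroup l F) := inferInstance
  have hI2 : (slI : SpecialLinearGroup (Fin 2) F) * slI = -1 := slI_sq
  have hJ2 : (slJ x y hxy : SpecialLinearGroup (Fin 2) F) * slJ x y hxy = -1 := slJ_sq x y hxy
  have hJI := slJI x y hxy
  obtain ⟨Q, hQ, hIQ, hJQ⟩ := quat_pgroup (I := (slI : SpecialLinearGroup (Fin 2) F)) (J := slJ x y hxy)
    (by rw [show 4 = 2 * 2 from rfl, pow_mul, pow_two slI, hI2]; simp)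
    (by rw [show 4 = 2 * 2 from rfl, pow_mul, pow_two (slJ x y hxy), hJ2]; simp)
    (by
      rw [hJI, mul_assoc, mul_assoc, mul_inv_cancel, mul_one]
      apply eq_inv_of_mul_eq_one_left
      rw [mul_assoc, hI2]; simp)
  have : Fact (Nat.Prime 2) := ⟨Nat.prime_two⟩
  have : Fact (Nat.Prime 3) := ⟨Nat.prime_three⟩
  obtain ⟨x0, hx0⟩ := hall_fix hH h2 Nat.prime_two
    ((Subgroup.pi Set.univ fun _ : l => Q).map embSL) ((pi_pgroup Q hQ).map _)
  have hH' := hall_conj hH x0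
  set H' := H.map (MulAut.conj x0).toMonoidHom with hH'def
  have hmem : ∀ g, x0⁻¹ * g * x0 ∈ H → g ∈ H' := by
    intro g hg
    refine ⟨_, hg, ?_⟩
    simp [mul_assoc]
  have hcube : (slA : SpecialLinearGroup (Fin 2) F) ^ (3 ^ 1) = 1 := by
    rw [pow_one]; have h := slA_cube (F := F); rw [pow_succ, pow_two]; first | exact h | simpa [pow_succ, mul_assoc] using h
  obtain ⟨z, hz⟩ := hall_fix hH' h3 Nat.prime_three
    ((Subgroup.pi Set.univ fun _ : l => Subgroup.zpowers (slA : SpecialLinearGroup (Fin 2) F)).map embSL)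
    ((pi_pgroup _ (zpowers_pgroup slA hcube)).map _)
  have hsing : ∀ (K : Subgroup (SpecialLinearGroup (Fin 2) F)) (a) (_ : a ∈ K) (i : l),
      embSL (Pi.mulSingle i a) ∈ (Subgroup.pi Set.univ fun _ : l => K).map embSL := by
    intro K a ha i
    refine ⟨_, ?_, rfl⟩
    intro k _
    by_cases h : k = i
    · subst h; simpa using ha
    · simp [Pi.mulSingle_eq_of_ne h]
  have hfr : ∀ h ∈ H', ∀ j : l, ∃ i, (h * z⁻¹).1 * Em j = Em i * (h * z⁻¹).1 := by
    intro h hh j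
    apply frame_main (ringChar F) H' (hne _ hH'.1) h2F h3F x y hxy
      (fun i => hmem _ (hx0 _ (hsing Q _ hIQ i))) (fun i => hmem _ (hx0 _ (hsing Q _ hJQ i)))
    have := hz _ (hsing _ _ (Subgroup.mem_zpowers slA) j)
    have h5 := H'.mul_mem (H'.mul_mem hh this) (H'.inv_mem hh)
    convert h5 using 1
    group
  refine ⟨H', hH', ?_⟩
  choose σ hσ using hfr 1 H'.one_mem
  have hinj : Function.Injective σ := by
    intro i j hij
    have h1 := hσ i
    rw [hij, ← hσ j] at h1
    exact E_inj (val_cancel_left _ h1)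
  have hsurj := Finite.injective_iff_surjective.1 hinj
  intro h hh k
  obtain ⟨j, rfl⟩ := hsurj k
  obtain ⟨i, hi⟩ := hfr h hh j
  refine ⟨i, ?_⟩
  have hs := hσ j
  rw [one_mul] at hs
  change h.1 * (z⁻¹).1 * _ = _ * (h.1 * (z⁻¹).1) at hi
  apply val_cancel z⁻¹
  rw [mul_assoc, ← hs, ← mul_assoc, hi, mul_assoc]

end red

section ord
variable {F l : Type*} [Field F] [Fintype l] [DecidableEq l]

theorem J_alt (a : l ⊕ l → F) : a ⬝ᵥ (J l F *ᵥ a) = 0 := by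
  simp [J, dotProduct, Fintype.sum_sum_type, mulVec, fromBlocks, one_apply, mul_comm]

theorem trans_mem (a : l ⊕ l → F) (c : F) : 1 + c • (vecMulVec a a * J l F) ∈ symplecticGroup l F := by
  rw [SymplecticGroup.mem_iff]
  have hT : (vecMulVec a a)ᵀ = vecMulVec a a := transpose_vecMulVec a a
  have h0 : vecMulVec a a * J l F * vecMulVec a a = 0 := by
    rw [mul_assoc, mul_vecMulVec, vecMulVec_mul_vecMulVec, J_alt]; simp
  have hJ := J_squared l F
  rw [transpose_add, transpose_smul, transpose_mul, hT, J_transpose, transpose_one]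
  set M := vecMulVec a a
  set K := J l F
  have e1 : M * K * K = - M := by rw [mul_assoc, hJ]; simp
  have e2 : K * (K * M) = - M := by rw [← mul_assoc, hJ]; simp
  simp only [add_mul, mul_add, one_mul, mul_one, smul_mul_assoc, mul_smul_comm, neg_mul, mul_neg, smul_neg, e1, e2]
  rw [← mul_assoc M K M, h0]
  simp

theorem sp_step (u w : l ⊕ l → F) (h : u ⬝ᵥ (J l F *ᵥ w) ≠ 0) : ∃ g : symplecticGroup l F, g.1 *ᵥ u = w := by
  have hs : ∀ a b : l ⊕ l → F, a ⬝ᵥ (J l F *ᵥ b) = - (b ⬝ᵥ (J l F *ᵥ a)) := by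
    intro a b
    have := J_alt (a + b)
    rw [mulVec_add, dotProduct_add, add_dotProduct, add_dotProduct, J_alt, J_alt] at this
    linear_combination this
  refine ⟨⟨_, trans_mem (w - u) (w ⬝ᵥ (J l F *ᵥ u))⁻¹⟩, ?_⟩
  rw [hs] at h
  have h' : w ⬝ᵥ (J l F *ᵥ u) ≠ 0 := fun h0 => h (by rw [h0]; simp)
  have e : (w - u) ⬝ᵥ (J l F *ᵥ u) = w ⬝ᵥ (J l F *ᵥ u) := by rw [sub_dotProduct, J_alt, sub_zero]
  simp only
  rw [add_mulVec, one_mulVec, smul_mulVec, ← mulVec_mulVec, vecMulVec_mulVec, e]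
  funext k
  simp
  field_simp
  ring

theorem sp_nondeg (u : l ⊕ l → F) (h : u ≠ 0) : ∃ s, u ⬝ᵥ (J l F *ᵥ s) ≠ 0 := by
  by_contra! hc
  apply h
  have : ∀ s, u ⬝ᵥ s = 0 := by
    intro s
    have := hc (-(J l F *ᵥ s))
    rwa [mulVec_neg, mulVec_mulVec, J_squared, neg_mulVec, one_mulVec, neg_neg] at this
  exact dotProduct_eq_zero u this

theorem sp_trans (u w : l ⊕ l → F) (hu : u ≠ 0) (hw : w ≠ 0) : ∃ g : symplecticGroup l F, g.1 *ᵥ u = w := by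
  obtain ⟨x, h1, h2⟩ : ∃ x, u ⬝ᵥ (J l F *ᵥ x) ≠ 0 ∧ w ⬝ᵥ (J l F *ᵥ x) ≠ 0 := by
    obtain ⟨s, hs⟩ := sp_nondeg u hu
    obtain ⟨t, ht⟩ := sp_nondeg w hw
    by_cases h1 : w ⬝ᵥ (J l F *ᵥ s) = 0
    · by_cases h2 : u ⬝ᵥ (J l F *ᵥ t) = 0
      · refine ⟨s + t, ?_, ?_⟩
        · rwa [mulVec_add, dotProduct_add, h2, add_zero]
        · rwa [mulVec_add, dotProduct_add, h1, zero_add]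
      · exact ⟨t, h2, ht⟩
    · exact ⟨s, hs, h1⟩
  obtain ⟨g, hg⟩ := sp_step u x h1
  obtain ⟨k, hk⟩ := sp_step w x h2
  refine ⟨k⁻¹ * g, ?_⟩
  have hw1 : (k⁻¹).1 * k.1 = 1 := congrArg Subtype.val (inv_mul_cancel k)
  change ((k⁻¹).1 * g.1) *ᵥ u = w
  rw [← mulVec_mulVec, hg, ← hk, mulVec_mulVec, hw1, one_mulVec]

/-- reindexing -/
theorem sp_card_congr {l' : Type*} [Fintype l'] [DecidableEq l'] (e : l ≃ l') :
    Nat.card (symplecticGroup l F) = Nat.card (symplecticGroup l' F) := by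
  have key : ∀ A : Matrix (l ⊕ l) (l ⊕ l) F, A ∈ symplecticGroup l F ↔
      (reindex (e.sumCongr e) (e.sumCongr e) A) ∈ symplecticGroup l' F := by
    intro A
    have hJ : J l' F = reindex (e.sumCongr e) (e.sumCongr e) (J l F) := by
      ext (i | i) (j | j) <;> simp [J, one_apply]
    rw [SymplecticGroup.mem_iff, SymplecticGroup.mem_iff, hJ]
    simp only [reindex_apply, transpose_submatrix, submatrix_mul_equiv]
    constructor
    · intro h; rw [h]
    · intro h
      exact (reindex (e.sumCongr e) (e.sumCongr e)).injective h
  exact Nat.card_congr ((reindex (e.sumCongr e) (e.sumCongr e)).subtypeEquiv key)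

def spUp (A : Matrix (l ⊕ l) (l ⊕ l) F) : Matrix ((l ⊕ Unit) ⊕ (l ⊕ Unit)) ((l ⊕ Unit) ⊕ (l ⊕ Unit)) F :=
  fromBlocks (fromBlocks A.toBlocks₁₁ 0 0 1) (fromBlocks A.toBlocks₁₂ 0 0 0)
    (fromBlocks A.toBlocks₂₁ 0 0 0) (fromBlocks A.toBlocks₂₂ 0 0 1)

theorem spUp_mul (A B : Matrix (l ⊕ l) (l ⊕ l) F) : spUp (A * B) = spUp A * spUp B := by
  rw [← fromBlocks_toBlocks A, ← fromBlocks_toBlocks B]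
  simp only [spUp, fromBlocks_multiply, toBlocks_fromBlocks₁₁, toBlocks_fromBlocks₁₂, toBlocks_fromBlocks₂₁, toBlocks_fromBlocks₂₂]
  simp [fromBlocks_add]

theorem spUp_mem {A : Matrix (l ⊕ l) (l ⊕ l) F} (h : A ∈ symplecticGroup l F) : spUp A ∈ symplecticGroup (l ⊕ Unit) F := by
  rw [← fromBlocks_toBlocks A, SymplecticGroup.fromBlocks_mem_iff] at h
  obtain ⟨h1, h2, h3⟩ := h
  rw [spUp, SymplecticGroup.fromBlocks_mem_iff]
  simp only [fromBlocks_transpose, fromBlocks_multiply]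
  refine ⟨?_, ?_, ?_⟩
  · simp [h1]
  · simp [h2]
  · simp [sub_eq_add_neg, fromBlocks_neg, fromBlocks_add]
    rw [← sub_eq_add_neg, h3, fromBlocks_one]

def spEmb : symplecticGroup l F →* symplecticGroup (l ⊕ Unit) F where
  toFun A := ⟨spUp A.1, spUp_mem A.2⟩
  map_one' := by
    apply Subtype.ext
    change spUp 1 = 1
    rw [spUp, ← fromBlocks_one (l := l) (m := l)]
    simp only [toBlocks_fromBlocks₁₁, toBlocks_fromBlocks₁₂, toBlocks_fromBlocks₂₁, toBlocks_fromBlocks₂₂]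
    simp
  map_mul' A B := Subtype.ext (spUp_mul _ _)

theorem spEmb_inj : Function.Injective (spEmb (F := F) (l := l)) := by
  intro A B h
  have h := congrArg Subtype.val h
  change spUp _ = spUp _ at h
  simp only [spUp, fromBlocks_inj] at h
  apply Subtype.ext
  rw [← fromBlocks_toBlocks A.1, ← fromBlocks_toBlocks B.1, h.1.1, h.2.1.1, h.2.2.1.1, h.2.2.2.1]

def spAct : MulAction (symplecticGroup l F) (l ⊕ l → F) where
  smul g v := g.1 *ᵥ v
  one_smul v := one_mulVec v
  mul_smul g h v := (mulVec_mulVec v g.1 h.1).symm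

theorem sp_dvd [Fintype F] : (Fintype.card F ^ (2 * (Fintype.card l + 1)) - 1) * Nat.card (symplecticGroup l F) ∣
    Nat.card (symplecticGroup (l ⊕ Unit) F) := by
  let _ := spAct (F := F) (l := l ⊕ Unit)
  let v : (l ⊕ Unit) ⊕ (l ⊕ Unit) → F := Pi.single (Sum.inl (Sum.inr ())) 1
  have hv : v ≠ 0 := by simp [v]
  have horb : MulAction.orbit (symplecticGroup (l ⊕ Unit) F) v = {0}ᶜ := by
    ext w
    constructor
    · rintro ⟨g, rfl⟩ h0
      have h0 : g.1 *ᵥ v = 0 := h0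
      have hw1 : (g⁻¹).1 * g.1 = 1 := congrArg Subtype.val (inv_mul_cancel g)
      apply hv
      rw [← one_mulVec v, ← hw1, ← mulVec_mulVec, h0, mulVec_zero]
    · intro hw
      exact sp_trans v w hv hw
  have hc := (MulAction.index_stabilizer (symplecticGroup (l ⊕ Unit) F) v).trans (congrArg Set.ncard horb)
  rw [Set.ncard_compl, Set.ncard_singleton, Nat.card_eq_fintype_card, Fintype.card_fun] at hc
  have hcard : Fintype.card ((l ⊕ Unit) ⊕ (l ⊕ Unit)) = 2 * (Fintype.card l + 1) := by
    simp; ring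
  rw [hcard] at hc
  rw [← Subgroup.index_mul_card (MulAction.stabilizer (symplecticGroup (l ⊕ Unit) F) v), hc]
  apply mul_dvd_mul_left
  have hle : (spEmb (F := F) (l := l)).range ≤ MulAction.stabilizer (symplecticGroup (l ⊕ Unit) F) v := by
    rintro _ ⟨g, rfl⟩
    change spUp g.1 *ᵥ v = v
    simp only [v, mulVec_single_one]
    funext k
    rcases k with (k | k) | (k | k) <;> simp [spUp]
  have := Subgroup.card_dvd_of_le hle
  rwa [← Nat.card_congr (MonoidHom.ofInjective spEmb_inj).toEquiv] at this

theorem sp_prod_dvd [Fintype F] (n : ℕ) : (∏ i ∈ Finset.range n, (Fintype.card F ^ (2 * (i + 1)) - 1)) ∣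
    Nat.card (symplecticGroup (Fin n) F) := by
  induction n with
  | zero => simp
  | succ n ih =>
    rw [Finset.prod_range_succ, mul_comm]
    have h := sp_dvd (F := F) (l := Fin n)
    rw [Fintype.card_fin, sp_card_congr (Fintype.equivOfCardEq (by simp) : Fin n ⊕ Unit ≃ Fin (n + 1))] at h
    exact (mul_dvd_mul_left _ ih).trans h

theorem card_Mon [Fintype F] : Nat.card (Mon F l) =
    Nat.card (SpecialLinearGroup (Fin 2) F) ^ Fintype.card l * (Fintype.card l).factorial := by
  have h1 := Subgroup.card_mul_index (theta F l).ker
  rw [Subgroup.index_ker, MonoidHom.range_eq_top.2 theta_surj, Subgroup.card_top, Nat.card_perm, Nat.card_eq_fintype_card (α := l)] at h1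
  rw [← h1, ← embMon_range, ← Nat.card_congr (MonoidHom.ofInjective embMon_inj).toEquiv, Nat.card_fun, Nat.card_eq_fintype_card (α := l)]

theorem card_SL_dvd [Fintype F] : Nat.card (SpecialLinearGroup (Fin 2) F) ∣
    (Fintype.card F ^ 2 - 1) * (Fintype.card F ^ 2 - Fintype.card F) := by
  have h := card_GL_field (𝔽 := F) 2
  rw [Fin.prod_univ_two] at h
  simp only [Fin.val_zero, Fin.val_one, pow_zero, pow_one] at h
  rw [← h]
  exact Subgroup.card_dvd_of_injective (SpecialLinearGroup.toGL) SpecialLinearGroup.toGL_injective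

end ord

end allhelpers

section arith

theorem val_prod_ge (r : ℕ) [Fact r.Prime] (hr : Odd r) (Q : ℕ) (hQ1 : 1 < Q) (hQ : r ∣ Q - 1) (N : ℕ) :
    padicValNat r N.factorial + N ≤ padicValNat r (∏ k ∈ Finset.range N, (Q ^ (k + 1) - 1)) := by
  have hrp : r.Prime := Fact.out
  have hpos : ∀ k, Q ^ (k + 1) - 1 ≠ 0 := by
    intro k
    have := Nat.one_lt_pow (Nat.succ_ne_zero k) hQ1
    exact Nat.sub_ne_zero_of_lt this
  induction N with
  | zero => simp
  | succ N ih =>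
    rw [Finset.prod_range_succ, padicValNat.mul (Finset.prod_ne_zero_iff.2 fun k _ => hpos k) (hpos N),
      Nat.factorial_succ, padicValNat.mul (Nat.succ_ne_zero N) (Nat.factorial_ne_zero N)]
    have hnd : ¬ r ∣ Q := by
      intro h
      have h1 : r ∣ Q - (Q - 1) := Nat.dvd_sub h hQ
      rw [Nat.sub_sub_self hQ1.le] at h1
      exact hrp.one_lt.ne' (Nat.dvd_one.1 h1)
    have h := padicValNat.pow_sub_pow (p := r) hr (y := 1) (x := Q) hQ1 hQ hnd (Nat.succ_ne_zero N)
    rw [one_pow] at h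
    have h1 : 1 ≤ padicValNat r (Q - 1) := one_le_padicValNat_of_dvd (Nat.sub_ne_zero_of_lt hQ1) hQ
    simp only [Nat.succ_eq_add_one] at h ⊢
    omega

theorem val_lt (r : ℕ) [Fact r.Prime] (hr : Odd r) (q : ℕ) (hq1 : 1 < q) (hq : ¬ r ∣ q) (n : ℕ) (hn : r ≤ n) :
    padicValNat r n.factorial < padicValNat r (∏ i ∈ Finset.range n, (q ^ (2 * (i + 1)) - 1)) := by
  have hrp : r.Prime := Fact.out
  obtain ⟨m, hm⟩ := hr
  have hm1 : 1 ≤ m := by have := hrp.two_le; omega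
  have hK1 : 1 ≤ n / r := (Nat.one_le_div_iff hrp.pos).2 hn
  have hKn : n / r * r ≤ n := Nat.div_mul_le_self n r
  set K := n / r with hK
  have hQ1 : 1 < q ^ (2 * m) := Nat.one_lt_pow (by omega) hq1
  have hQ : r ∣ q ^ (2 * m) - 1 := by
    have h1 := Nat.ModEq.pow_totient ((Nat.Prime.coprime_iff_not_dvd hrp).2 hq).symm
    rw [Nat.totient_prime hrp, hm, Nat.add_sub_cancel] at h1
    rw [hm]
    exact (Nat.modEq_iff_dvd' hQ1.le).1 h1.symm
  have h1 := val_prod_ge r ⟨m, hm⟩ _ hQ1 hQ (2 * K)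
  have hpos : ∀ i, q ^ (2 * (i + 1)) - 1 ≠ 0 := by
    intro k
    have := Nat.one_lt_pow (show 2 * (k + 1) ≠ 0 by omega) hq1
    exact Nat.sub_ne_zero_of_lt this
  have hdvd : (∏ k ∈ Finset.range (2 * K), ((q ^ (2 * m)) ^ (k + 1) - 1)) ∣ ∏ i ∈ Finset.range n, (q ^ (2 * (i + 1)) - 1) := by
    have hinj : Function.Injective (fun k : ℕ => (k + 1) * m - 1) := by
      intro a b hab
      have ha : 1 ≤ (a + 1) * m := Nat.mul_pos (Nat.succ_pos a) hm1
      have hb : 1 ≤ (b + 1) * m := Nat.mul_pos (Nat.succ_pos b) hm1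
      simp only at hab
      have : (a + 1) * m = (b + 1) * m := by omega
      have := Nat.eq_of_mul_eq_mul_right hm1 this
      omega
    have h2 : (∏ k ∈ Finset.range (2 * K), ((q ^ (2 * m)) ^ (k + 1) - 1)) =
        ∏ i ∈ (Finset.range (2 * K)).map ⟨_, hinj⟩, (q ^ (2 * (i + 1)) - 1) := by
      rw [Finset.prod_map]
      apply Finset.prod_congr rfl
      intro k _
      have ha : 1 ≤ (k + 1) * m := Nat.mul_pos (Nat.succ_pos k) hm1
      simp only [Function.Embedding.coeFn_mk]
      rw [Nat.sub_add_cancel ha, ← pow_mul]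
      congr 2
      ring
    rw [h2]
    apply Finset.prod_dvd_prod_of_subset
    intro i hi
    simp only [Finset.mem_map, Finset.mem_range, Function.Embedding.coeFn_mk] at hi ⊢
    obtain ⟨k, hk, rfl⟩ := hi
    have h3 : (k + 1) * m ≤ 2 * K * m := Nat.mul_le_mul_right _ hk
    have h4 : K * r = 2 * K * m + K := by rw [hm]; ring
    omega
  have h5 : padicValNat r (∏ k ∈ Finset.range (2 * K), ((q ^ (2 * m)) ^ (k + 1) - 1)) ≤ _ :=
    padicValNat_dvd_iff_le (p := r) (Finset.prod_ne_zero_iff.2 fun k _ => hpos k) |>.1 (pow_padicValNat_dvd.trans hdvd)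
  have h6 : padicValNat r n.factorial = padicValNat r K.factorial + K := by
    rw [← padicValNat_mul_div_factorial n, ← hK, padicValNat_factorial_mul]
  have h7 : padicValNat r K.factorial ≤ padicValNat r (2 * K).factorial :=
    padicValNat_dvd_iff_le (p := r) (Nat.factorial_ne_zero _) |>.1
      (pow_padicValNat_dvd.trans (Nat.factorial_dvd_factorial (by omega)))
  omega

theorem third_claim {F : Type*} [Field F] [Fintype F] (n : ℕ) (hqodd : Odd (Fintype.card F)) {π : Set ℕ} (hp : ringChar F ∉ π)
    (H : Subgroup (Matrix.symplecticGroup (Fin n) F)) (hH : IsHallPi π H) (hM : H ≤ Mon F (Fin n))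
    (r : ℕ) (hr : r ∈ π) (hrp : r.Prime) (hd : r ∣ Nat.card (Matrix.symplecticGroup (Fin n) F)) :
    r ∣ Fintype.card F ^ 2 - 1 := by
  by_contra hnd
  have : Fact r.Prime := ⟨hrp⟩
  have hpp : (ringChar F).Prime := CharP.char_is_prime F (ringChar F)
  have hq1 : 1 < Fintype.card F := Fintype.one_lt_card
  set q := Fintype.card F with hq
  have hodd : Odd r := by
    rcases hrp.eq_two_or_odd' with rfl | h
    · exfalso
      apply hnd
      obtain ⟨t, ht⟩ := hqodd
      rw [ht]
      have : (2 * t + 1) ^ 2 = 2 * (2 * t ^ 2 + 2 * t) + 1 := by ring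
      rw [this, Nat.add_sub_cancel]
      exact dvd_mul_right _ _
    · exact h
  have hrq : ¬ r ∣ q := by
    intro h
    obtain ⟨k, _, hk⟩ := FiniteField.card F (ringChar F)
    rw [hq, hk] at h
    have := (Nat.prime_dvd_prime_iff_eq hrp hpp).1 (hrp.dvd_of_dvd_pow h)
    exact hp (this ▸ hr)
  have hSL : ¬ r ∣ Nat.card (Matrix.SpecialLinearGroup (Fin 2) F) := by
    intro h
    have h1 := h.trans card_SL_dvd
    rcases (Nat.Prime.dvd_mul hrp).1 h1 with h2 | h2
    · exact hnd h2
    · rw [show q ^ 2 - q = q * (q - 1) by rw [Nat.mul_sub, mul_one, pow_two]] at h2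
      rcases (Nat.Prime.dvd_mul hrp).1 h2 with h3 | h3
      · exact hrq h3
      · apply hnd
        rw [show q ^ 2 - 1 = (q + 1) * (q - 1) by rw [← Nat.sq_sub_sq, one_pow]]
        exact h3.mul_left _
  have : Finite (Matrix.symplecticGroup (Fin n) F) := inferInstance
  have hG0 : Nat.card (Matrix.symplecticGroup (Fin n) F) ≠ 0 := Nat.card_pos.ne'
  have hval : padicValNat r (Nat.card (Matrix.symplecticGroup (Fin n) F)) = padicValNat r (Nat.card H) := by
    rw [← Subgroup.card_mul_index H, padicValNat.mul Nat.card_pos.ne' Subgroup.index_ne_zero_of_finite,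
      padicValNat.eq_zero_of_not_dvd (hH.2 r hr hrp), add_zero]
  have hSLpos : Nat.card (Matrix.SpecialLinearGroup (Fin 2) F) ≠ 0 := Nat.card_pos.ne'
  have hle : padicValNat r (Nat.card H) ≤ padicValNat r n.factorial := by
    have h1 : padicValNat r (Nat.card (Mon F (Fin n))) = padicValNat r n.factorial := by
      rw [card_Mon, Fintype.card_fin, padicValNat.mul (pow_ne_zero _ hSLpos) (Nat.factorial_ne_zero n),
        padicValNat.pow, padicValNat.eq_zero_of_not_dvd hSL, mul_zero, zero_add]
    rw [← h1]
    exact padicValNat_dvd_iff_le (p := r) Nat.card_pos.ne' |>.1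
      (pow_padicValNat_dvd.trans (Subgroup.card_dvd_of_le hM))
  have h1 := one_le_padicValNat_of_dvd hG0 hd
  have hrn : r ≤ n := by
    rw [← hrp.dvd_factorial]
    exact dvd_of_one_le_padicValNat (by omega)
  have h2 := val_lt r hodd q hq1 hrq n hrn
  have h3 : padicValNat r (∏ i ∈ Finset.range n, (q ^ (2 * (i + 1)) - 1)) ≤ _ :=
    padicValNat_dvd_iff_le (p := r) hG0 |>.1 (pow_padicValNat_dvd.trans (sp_prod_dvd n))
  omega

end arith

theorem stmt_18 (n : ℕ) (hn : 1 ≤ n)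
    (F : Type*) [Field F] [Fintype F]
    (q : ℕ) (hq : q = Fintype.card F) (hqodd : Odd q)
    (π : Set ℕ) (h2 : 2 ∈ π) (h3 : 3 ∈ π) (hp : ringChar F ∉ π)
    (hE : ∃ H : Subgroup (Matrix.symplecticGroup (Fin n) F), IsHallPi π H) :
    (∃ H : Subgroup (Equiv.Perm (Fin n)), IsHallPi π H) ∧
    (∃ H : Subgroup (Matrix.SpecialLinearGroup (Fin 2) F), IsHallPi π H) ∧
    (∀ r ∈ π, r.Prime → r ∣ Nat.card (Matrix.symplecticGroup (Fin n) F) →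
      r ∣ (q ^ 2 - 1)) := by
  subst hq
  obtain ⟨H, hH⟩ := hE
  obtain ⟨H', hH', hM⟩ := hall_in_mon h2 h3 hp H hH
  obtain ⟨c1, c2⟩ := mon_hall ⟨0, hn⟩ H' hH' hM
  exact ⟨c1, c2, fun r hr hrp hd => third_claim n hqodd hp H' hH' hM r hr hrp hd⟩
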